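/- arXiv:2003.02127 — 2 statements merged into one kernel-verified Lean document; each statement's English description precedes it below -/
import Mathlib

section
/- Let n ≥ p ≥ 1 be integers and let f : ℝⁿ → ℝᵖ be real analytic on a neighbourhood of 0 with f(0)=0. Then for every positive integer m, K_m(f,·) ≈ T_m(f,·); that is, there exist constants K, δ > 0 such that K_m(f,x) ≤ K·T_m(f,x) for all ‖x‖ ≤ δ, and constants K', δ' > 0 such that T_m(f,x) ≤ K'·K_m(f,x) for all ‖x‖ ≤ δ'. -/
open scoped Classical in
/-- The Kuo quantity `K_m(f,x)`. -/
noncomputable def KuoQ (n p m : ℕ)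
    (f : EuclideanSpace ℝ (Fin n) → EuclideanSpace ℝ (Fin p))
    (x : EuclideanSpace ℝ (Fin n)) : ℝ :=
  ‖x‖ ^ m *
      ∑ ι : Fin p → Fin n,
        (if StrictMono ι then
          |(Matrix.det fun j k : Fin p =>
              fderiv ℝ f x (EuclideanSpace.single (ι k) 1) j)| ^ m
        else 0)
    + ‖f x‖ ^ m

open scoped Classical in
/-- The Thom quantity `T_m(f,x)`. -/
noncomputable def ThomQ (n p m : ℕ)
    (f : EuclideanSpace ℝ (Fin n) → EuclideanSpace ℝ (Fin p))
    (x : EuclideanSpace ℝ (Fin n)) : ℝ :=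
  (∑ ι : Fin (p + 1) → Fin n,
      if StrictMono ι then
        |(Matrix.det fun j k : Fin (p + 1) =>
            if h : (j : ℕ) < p then fderiv ℝ f x (EuclideanSpace.single (ι k) 1) ⟨j, h⟩
            else 2 * x (ι k))| ^ m
      else 0)
    + ‖f x‖ ^ m

open Filter Topology

section Division

variable {V : Type*} [NormedAddCommGroup V] [NormedSpace ℝ V]

/-- The coefficients of the quotient of a power series by a linear form, see
`AnalyticAt.exists_eq_mul_of_vanishing`. -/
noncomputable def quotientSeries (p : FormalMultilinearSeries ℝ V ℝ) (P : V →L[ℝ] V) (e : V) :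
    FormalMultilinearSeries ℝ V ℝ := fun k =>
  ∑ j : Fin (k + 1), ((p (k + 1)).curryMid j e).compContinuousLinearMap
    (fun i : Fin k => if i.castSucc < j then ContinuousLinearMap.id ℝ V else P)

theorem quotientSeries_apply (p : FormalMultilinearSeries ℝ V ℝ) (l : V →L[ℝ] ℝ) (P : V →L[ℝ] V)
    (e : V) (hP : ∀ v, v - P v = l v • e) (k : ℕ) (v : V) :
    p (k + 1) (fun _ => v) - p (k + 1) (fun _ => P v) =
      l v * quotientSeries p P e k (fun _ => v) := by
  have hS : ∀ j : Fin (k + 1),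
      p (k + 1) (fun i => if (i : ℕ) < (j : ℕ) + 1 then v else P v) -
        p (k + 1) (fun i => if (i : ℕ) < (j : ℕ) then v else P v) =
      l v * ((p (k + 1)).curryMid j e).compContinuousLinearMap
        (fun i : Fin k => if i.castSucc < j then ContinuousLinearMap.id ℝ V else P)
          (fun _ => v) := by
    intro j
    set rest : Fin k → V := fun i => if i.castSucc < j then v else P v with hrest
    have key : ∀ i : Fin k, (if ((j.succAbove i : Fin (k+1)) : ℕ) < (j : ℕ) then v else P v)
        = rest i ∧ (if ((j.succAbove i : Fin (k+1)) : ℕ) < (j : ℕ) + 1 then v else P v)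
        = rest i := by
      intro i
      by_cases h : i.castSucc < j
      · have h' : (i : ℕ) < j := h
        rw [Fin.succAbove_of_castSucc_lt _ _ h]
        simp [hrest, h, h', Nat.lt_succ_of_lt h']
      · have h' : ¬ (i : ℕ) < j := h
        rw [Fin.succAbove_of_le_castSucc _ _ (not_lt.1 h)]
        have h1 : ¬ ((i : ℕ) + 1 < j) := by omega
        simp [hrest, h, h', h1]
    have h1 : (fun i : Fin (k + 1) => if (i : ℕ) < (j : ℕ) + 1 then v else P v) =
        j.insertNth (α := fun _ => V) v rest := by
      refine Fin.eq_insertNth_iff.2 ⟨by simp, ?_⟩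
      funext i
      exact (key i).2
    have h2 : (fun i : Fin (k + 1) => if (i : ℕ) < (j : ℕ) then v else P v) =
        j.insertNth (α := fun _ => V) (P v) rest := by
      refine Fin.eq_insertNth_iff.2 ⟨by simp, ?_⟩
      funext i
      exact (key i).1
    rw [h1, h2, ← ContinuousMultilinearMap.curryMid_apply, ← ContinuousMultilinearMap.curryMid_apply,
      ← sub_apply, ← map_sub, hP, map_smul]
    simp only [smul_apply, smul_eq_mul,
      ContinuousMultilinearMap.compContinuousLinearMap_apply]
    congr 2
    funext i
    by_cases h : i.castSucc < j <;> simp [hrest, h]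
  have hT := Finset.sum_range_sub
    (fun j : ℕ => p (k + 1) (fun i => if (i : ℕ) < j then v else P v)) (k + 1)
  have e1 : (fun i : Fin (k + 1) => if (i : ℕ) < k + 1 then v else P v) = fun _ => v := by
    funext i; simp [i.2]
  have e2 : (fun i : Fin (k + 1) => if (i : ℕ) < 0 then v else P v) = fun _ => P v := by
    funext i; simp
  rw [e1, e2] at hT
  rw [← hT, Finset.sum_range, quotientSeries, sum_apply, Finset.mul_sum]
  exact Finset.sum_congr rfl fun j _ => hS j

theorem quotientSeries_radius_pos (p : FormalMultilinearSeries ℝ V ℝ) (hp : 0 < p.radius)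
    (P : V →L[ℝ] V) (e : V) : 0 < (quotientSeries p P e).radius := by
  obtain ⟨C, r, hC, hr, hb⟩ := p.le_mul_pow_of_radius_pos hp
  set M : ℝ := 1 + ‖P‖ with hM
  have hM1 : 1 ≤ M := by simp [hM]
  have hMpos : 0 < M := by linarith
  have hbound : ∀ k, ‖quotientSeries p P e k‖ ≤ (C * r * ‖e‖) * (2 * r * M) ^ k := by
    intro k
    have h1 : ‖quotientSeries p P e k‖ ≤ ∑ j : Fin (k + 1), (C * r ^ (k + 1)) * ‖e‖ * M ^ k := by
      refine (norm_sum_le _ _).trans (Finset.sum_le_sum fun j _ => ?_)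
      refine (ContinuousMultilinearMap.norm_compContinuousLinearMap_le _ _).trans ?_
      have h2 : ∏ i : Fin k, ‖(if i.castSucc < j then ContinuousLinearMap.id ℝ V else P)‖ ≤
          M ^ k := by
        refine (Finset.prod_le_prod (fun _ _ => norm_nonneg _)
          (g := fun _ => M) fun i _ => ?_).trans (by simp)
        split_ifs
        · exact ContinuousLinearMap.norm_id_le.trans hM1
        · simp [hM]
      have h3 : ‖(p (k + 1)).curryMid j e‖ ≤ C * r ^ (k + 1) * ‖e‖ := by
        refine (ContinuousLinearMap.le_opNorm _ _).trans ?_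
        rw [ContinuousMultilinearMap.norm_curryMid]
        exact mul_le_mul_of_nonneg_right (hb _) (norm_nonneg _)
      exact mul_le_mul h3 h2 (Finset.prod_nonneg fun _ _ => norm_nonneg _) (by positivity)
    refine h1.trans ?_
    have h4 : ((k : ℝ) + 1) ≤ 2 ^ k := by exact_mod_cast Nat.lt_two_pow_self (n := k)
    simp only [Finset.sum_const, Finset.card_univ, Fintype.card_fin, nsmul_eq_mul]
    push_cast
    have : (C * r * ‖e‖) * (2 * r * M) ^ k = 2 ^ k * (C * r ^ (k + 1) * ‖e‖ * M ^ k) := by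
      rw [mul_pow, mul_pow]; ring
    rw [this]
    exact mul_le_mul_of_nonneg_right h4 (by positivity)
  have hpos : 0 < 2 * r * M := by positivity
  refine lt_of_lt_of_le ?_ ((quotientSeries p P e).le_radius_of_bound (C * r * ‖e‖)
    (r := (⟨(2 * r * M)⁻¹, by positivity⟩ : NNReal)) fun k => ?_)
  · exact ENNReal.coe_pos.2 (show (0 : ℝ) < (2 * r * M)⁻¹ by positivity)
  · calc _ ≤ (C * r * ‖e‖) * (2 * r * M) ^ k * ((2 * r * M)⁻¹) ^ k :=
        mul_le_mul_of_nonneg_right (hbound k) (by positivity)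
      _ = C * r * ‖e‖ := by
        rw [mul_assoc, ← mul_pow, mul_inv_cancel₀ hpos.ne', one_pow, mul_one]

/-- An analytic germ vanishing on the hyperplane `l = 0` is divisible by `l`. -/
theorem AnalyticAt.exists_eq_mul_of_vanishing (l : V →L[ℝ] ℝ) (e : V) (he : l e = 1) {f : V → ℝ}
    (hf : AnalyticAt ℝ f 0) (h0 : ∀ᶠ v in 𝓝 0, l v = 0 → f v = 0) :
    ∃ g, AnalyticAt ℝ g 0 ∧ ∀ᶠ v in 𝓝 0, f v = l v * g v := by
  obtain ⟨p, hp⟩ := hf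
  set P : V →L[ℝ] V := ContinuousLinearMap.id ℝ V - l.smulRight e with hPdef
  have hP : ∀ v, v - P v = l v • e := fun v => by simp [hPdef]
  have hlP : ∀ v, l (P v) = 0 := fun v => by simp [hPdef, he]
  set q := quotientSeries p P e with hq
  have hqr : 0 < q.radius := quotientSeries_radius_pos p hp.radius_pos P e
  have hqs := q.hasFPowerSeriesOnBall hqr
  refine ⟨q.sum, hqs.analyticAt, ?_⟩
  have hPt : Tendsto P (𝓝 0) (𝓝 0) := by simpa using P.continuous.tendsto 0
  have hs := hp.eventually_hasSum
  filter_upwards [hs, hPt.eventually hs, hqs.hasFPowerSeriesAt.eventually_hasSum,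
    hPt.eventually h0] with v h1 h2 h3 h4
  simp only [zero_add] at h1 h2 h3
  rw [h4 (hlP v)] at h2
  have h5 := h1.sub h2
  have h6 : HasSum (fun k => p (k + 1) (fun _ => v) - p (k + 1) (fun _ => P v)) (f v - 0) := by
    have := (hasSum_nat_add_iff' 1).2 h5
    have e0 : (p 0 fun _ => v) = p 0 fun _ => P v := by congr 1; funext i; exact i.elim0
    simpa [e0] using this
  have h7 := h3.mul_left (l v)
  rw [sub_zero] at h6
  simp only [hq, ← quotientSeries_apply p l P e hP] at h7
  exact h6.unique h7

end Division

theorem AnalyticAt.eventually_eq_zero_or_eq_zero_of_mul {V : Type*} [NormedAddCommGroup V]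
    [NormedSpace ℝ V] {f g : V → ℝ} (hf : AnalyticAt ℝ f 0) (hg : AnalyticAt ℝ g 0)
    (h : ∀ᶠ v in 𝓝 0, f v * g v = 0) : (∀ᶠ v in 𝓝 0, f v = 0) ∨ ∀ᶠ v in 𝓝 0, g v = 0 := by
  obtain ⟨r, hr, hball⟩ := Metric.eventually_nhds_iff_ball.1
    (hf.eventually_analyticAt.and (hg.eventually_analyticAt.and h))
  by_cases hz : ∀ v ∈ Metric.ball (0 : V) r, f v = 0
  · exact Or.inl (Metric.eventually_nhds_iff_ball.2 ⟨r, hr, hz⟩)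
  · push Not at hz
    obtain ⟨x, hx, hfx⟩ := hz
    right
    have hgx : g =ᶠ[𝓝 x] 0 := by
      filter_upwards [(hball x hx).1.continuousAt.eventually_ne hfx,
        Metric.isOpen_ball.mem_nhds hx] with v hv hvb
      exact (mul_eq_zero.1 (hball v hvb).2.2).resolve_left hv
    have := AnalyticOnNhd.eqOn_zero_of_preconnected_of_eventuallyEq_zero
      (f := g) (U := Metric.ball 0 r) (fun v hv => (hball v hv).2.1)
      (convex_ball 0 r).isPreconnected hx hgx
    exact Metric.eventually_nhds_iff_ball.2 ⟨r, hr, this⟩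

theorem iteratedDeriv_of_eventuallyEq_sum_add {G v : ℝ → ℝ} {c : ℕ → ℝ} {N : ℕ}
    (hv : AnalyticAt ℝ v 0)
    (hG : ∀ᶠ y in 𝓝 0, G y = ∑ i ∈ Finset.range N, c i * y ^ i + y ^ N * v y) {i : ℕ}
    (hi : i < N) : iteratedDeriv i G 0 = i.factorial * c i := by
  have hs : AnalyticAt ℝ (fun y : ℝ => ∑ i ∈ Finset.range N, c i * y ^ i) 0 := by fun_prop
  have hr : AnalyticAt ℝ (fun y : ℝ => y ^ N * v y) 0 := by fun_prop
  have ho : (N : ℕ∞) ≤ analyticOrderAt (fun y : ℝ => y ^ N * v y) 0 :=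
    (natCast_le_analyticOrderAt hr).2 ⟨v, hv, by simp⟩
  have hz := (natCast_le_analyticOrderAt_iff_iteratedDeriv_eq_zero hr).1 ho i hi
  rw [Filter.EventuallyEq.iteratedDeriv_eq (g := fun y => (∑ i ∈ Finset.range N, c i * y ^ i) +
    y ^ N * v y) i hG, iteratedDeriv_fun_add hs.contDiffAt hr.contDiffAt, hz, add_zero]
  simp (disch := fun_prop) only [iteratedDeriv_fun_sum, iteratedDeriv_const_mul_field,
    iteratedDeriv_fun_pow_zero]
  simp [Finset.sum_ite_eq_of_mem _ _ _ (Finset.mem_range.mpr hi), mul_comm]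

section Expansion

variable {E : Type*} [NormedAddCommGroup E] [NormedSpace ℝ E]

theorem AnalyticAt.comp_fst_zero {f : E × ℝ → ℝ} (hf : AnalyticAt ℝ f 0) :
    AnalyticAt ℝ (fun x : E => f (x, 0)) 0 := by
  have h0 : AnalyticAt ℝ (fun x : E => (x, (0 : ℝ))) 0 := by fun_prop
  exact AnalyticAt.fun_comp (f := fun x : E => (x, (0 : ℝ))) hf h0

/-- Taylor expansion with respect to the last variable. -/
theorem AnalyticAt.exists_expansion {f : E × ℝ → ℝ} (hf : AnalyticAt ℝ f 0) (d : ℕ) :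
    ∃ (a : ℕ → E → ℝ) (u : E × ℝ → ℝ), (∀ i, AnalyticAt ℝ (a i) 0) ∧ AnalyticAt ℝ u 0 ∧
      ∀ᶠ z in 𝓝 0, f z = ∑ i ∈ Finset.range d, a i z.1 * z.2 ^ i + z.2 ^ d * u z := by
  induction d with
  | zero => exact ⟨fun _ _ => 0, f, fun _ => analyticAt_const, hf, by simp⟩
  | succ d ih =>
    obtain ⟨a, u, ha, hu, h⟩ := ih
    have hu0 : AnalyticAt ℝ (fun z : E × ℝ => u (z.1, 0)) 0 :=
      AnalyticAt.fun_comp (g := fun x : E => u (x, 0)) (f := Prod.fst) (x := (0 : E × ℝ))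
        hu.comp_fst_zero analyticAt_fst
    obtain ⟨g, hg, hgu⟩ := AnalyticAt.exists_eq_mul_of_vanishing
      (ContinuousLinearMap.snd ℝ E ℝ) ((0 : E), (1 : ℝ)) rfl (hu.fun_sub hu0)
      (Eventually.of_forall fun z hz => by
        have : z.2 = 0 := hz
        rw [sub_eq_zero, ← this])
    refine ⟨Function.update a d fun x => u (x, 0), g, fun i => ?_, hg, ?_⟩
    · rcases eq_or_ne i d with rfl | hi
      · simpa using hu.comp_fst_zero
      · simpa [hi] using ha i
    · filter_upwards [h, hgu] with z hz hz'
      have hz'' : u z = u (z.1, 0) + z.2 * g z := by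
        have : u z - u (z.1, 0) = z.2 * g z := hz'
        linarith
      rw [hz, Finset.sum_range_succ, Function.update_self, hz'']
      have : ∑ i ∈ Finset.range d, Function.update a d (fun x => u (x, 0)) i z.1 * z.2 ^ i =
          ∑ i ∈ Finset.range d, a i z.1 * z.2 ^ i :=
        Finset.sum_congr rfl fun i hi => by
          rw [Function.update_of_ne (Finset.mem_range.1 hi).ne]
      rw [this]
      ring

theorem expansion_at_zero {f : E × ℝ → ℝ} {a : ℕ → E → ℝ} {u : E × ℝ → ℝ} {d : ℕ}
    (hf : AnalyticAt ℝ f 0) (hu : AnalyticAt ℝ u 0)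
    (h : ∀ᶠ z in 𝓝 0, f z = ∑ i ∈ Finset.range d, a i z.1 * z.2 ^ i + z.2 ^ d * u z)
    (ho : analyticOrderAt (fun t => f (0, t)) 0 = d) : (∀ i < d, a i 0 = 0) ∧ u 0 ≠ 0 := by
  have hι : AnalyticAt ℝ (fun t : ℝ => ((0 : E), t)) 0 := by fun_prop
  have ht : Tendsto (fun t : ℝ => ((0 : E), t)) (𝓝 0) (𝓝 0) := hι.continuousAt.tendsto
  have hf' : AnalyticAt ℝ (fun t : ℝ => f (0, t)) 0 :=
    AnalyticAt.fun_comp (f := fun t : ℝ => ((0 : E), t)) hf hι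
  have hu' : AnalyticAt ℝ (fun t : ℝ => u (0, t)) 0 :=
    AnalyticAt.fun_comp (f := fun t : ℝ => ((0 : E), t)) hu hι
  have h' := ht.eventually h
  have ha : ∀ i < d, a i 0 = 0 := by
    intro i hi
    have h1 := iteratedDeriv_of_eventuallyEq_sum_add (c := fun i => a i 0) hu' h' hi
    have h2 := (natCast_le_analyticOrderAt_iff_iteratedDeriv_eq_zero hf').1 ho.ge i hi
    rw [h2] at h1
    exact (mul_eq_zero.1 h1.symm).resolve_left (by positivity)
  refine ⟨ha, fun hu0 => ?_⟩
  have h3 : (fun t => f (0, t)) =ᶠ[𝓝 0] (fun t => t ^ d) * fun t => u (0, t) := by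
    filter_upwards [h'] with t ht
    rw [ht, Finset.sum_eq_zero (fun i hi => by
      rw [show a i ((0 : E), t).1 = a i 0 from rfl, ha i (Finset.mem_range.1 hi), zero_mul])]
    simp
  rw [analyticOrderAt_congr h3, analyticOrderAt_mul (by fun_prop) hu'] at ho
  have h4 : analyticOrderAt (fun t : ℝ => t ^ d) 0 = d :=
    (AnalyticAt.analyticOrderAt_eq_natCast (by fun_prop)).2
      ⟨fun _ => 1, analyticAt_const, one_ne_zero, by simp⟩
  rw [h4] at ho
  have h5 : analyticOrderAt (fun t : ℝ => u (0, t)) 0 ≠ 0 := by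
    rw [hu'.analyticOrderAt_ne_zero]; exact hu0
  refine h5 ?_
  have h6 : analyticOrderAt (fun t : ℝ => u (0, t)) 0 + (d : ℕ∞) = 0 + d := by
    rw [zero_add, add_comm, ho]
  exact ENat.add_left_injective_of_ne_top (ENat.natCast_ne_top d) h6

/-- Tschirnhaus transformation: after a translation of the last variable, an analytic germ of
order `k + 1` in that variable has no term of degree `k`. -/
theorem AnalyticAt.exists_tschirnhaus [CompleteSpace E] {f : E × ℝ → ℝ} (hf : AnalyticAt ℝ f 0)
    (k : ℕ) (ho : analyticOrderAt (fun t => f (0, t)) 0 = (k + 1 : ℕ)) :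
    ∃ (φ : E → ℝ) (a : ℕ → E → ℝ) (u : E × ℝ → ℝ), AnalyticAt ℝ φ 0 ∧ φ 0 = 0 ∧
      (∀ i, AnalyticAt ℝ (a i) 0) ∧ AnalyticAt ℝ u 0 ∧ (∀ i < k, a i 0 = 0) ∧ u 0 ≠ 0 ∧
      ∀ᶠ z in 𝓝 0, f (z.1, φ z.1 + z.2) =
        ∑ i ∈ Finset.range k, a i z.1 * z.2 ^ i + z.2 ^ (k + 1) * u z := by
  have hσ : AnalyticAt ℝ (fun w : (E × ℝ) × ℝ => (w.1.1, w.1.2 + w.2)) 0 :=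
    ((ContinuousLinearMap.fst ℝ E ℝ ∘L .fst ℝ (E × ℝ) ℝ).prod
      (ContinuousLinearMap.snd ℝ E ℝ ∘L .fst ℝ (E × ℝ) ℝ + .snd ℝ (E × ℝ) ℝ)).analyticAt 0
  have hF : AnalyticAt ℝ (fun w : (E × ℝ) × ℝ => f (w.1.1, w.1.2 + w.2)) 0 :=
    AnalyticAt.fun_comp (f := fun w : (E × ℝ) × ℝ => (w.1.1, w.1.2 + w.2))
      (by simpa [Prod.mk_zero_zero] using hf) hσ
  obtain ⟨A, u, hA, hu, hexp⟩ := hF.exists_expansion (k + 1)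
  have hf0 : AnalyticAt ℝ (fun t => f (0, t)) 0 :=
    AnalyticAt.fun_comp (f := fun t : ℝ => ((0 : E), t)) hf (by fun_prop)
  have hD := analyticOrderAt_iterated_deriv hf0 (k := k) ho.symm (by simp) (by simp)
  -- the coefficient of degree `k` at `(0, s)` is a `k`-th derivative
  have hcoef : ∀ᶠ s : ℝ in 𝓝 0,
      deriv^[k] (fun t => f (0, t)) s = k.factorial * A k (0, s) := by
    have hpre : Tendsto (fun s : ℝ => (((0 : E), s), (0 : ℝ))) (𝓝 0) (𝓝 0) :=
      (show Continuous (fun s : ℝ => (((0 : E), s), (0 : ℝ))) by fun_prop).tendsto' _ _ rfl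
    filter_upwards [hpre.eventually hexp.eventually_nhds,
      hpre.eventually hu.eventually_analyticAt] with s hs hus
    have hι : AnalyticAt ℝ (fun y : ℝ => (((0 : E), s), y)) 0 := by fun_prop
    have hus' : AnalyticAt ℝ (fun y : ℝ => u ((0, s), y)) 0 :=
      AnalyticAt.fun_comp (f := fun y : ℝ => (((0 : E), s), y)) hus hι
    have h1 := iteratedDeriv_of_eventuallyEq_sum_add (G := fun y => f (0, s + y))
      (c := fun i => A i (0, s)) hus' (hι.continuousAt.tendsto.eventually hs) (Nat.lt_succ_self k)
    rw [← h1, iteratedDeriv_comp_const_add k (fun t => f (0, t)) s]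
    simp [iteratedDeriv_eq_iterate]
  have hAk0 : AnalyticAt ℝ (fun s : ℝ => A k (0, s)) 0 :=
    AnalyticAt.fun_comp (f := fun s : ℝ => ((0 : E), s)) (hA k) (by fun_prop)
  have hkf : (k.factorial : ℝ) ≠ 0 := by positivity
  have hord1 : analyticOrderAt (fun s : ℝ => (k.factorial : ℝ) * A k (0, s)) 0 = 1 := by
    rw [← analyticOrderAt_congr (f := deriv^[k] fun t => f (0, t)) hcoef, hD]
    simp
  have hh0 : A k 0 = 0 := by
    have : (k.factorial : ℝ) * A k (0, 0) = 0 := by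
      have h := (analyticAt_const.fun_mul hAk0 :
        AnalyticAt ℝ (fun s : ℝ => (k.factorial : ℝ) * A k (0, s)) 0).analyticOrderAt_ne_zero.1
        (by rw [hord1]; exact one_ne_zero)
      exact h
    exact (mul_eq_zero.1 this).resolve_left hkf
  have hh1 : deriv (fun s : ℝ => A k (0, s)) 0 ≠ 0 := by
    intro hd
    have hle : ((2 : ℕ) : ℕ∞) ≤ analyticOrderAt (fun s : ℝ => (k.factorial : ℝ) * A k (0, s)) 0 := by
      rw [natCast_le_analyticOrderAt_iff_iteratedDeriv_eq_zero (analyticAt_const.fun_mul hAk0)]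
      intro i hi
      interval_cases i
      · simpa [hkf, Prod.mk_zero_zero] using hh0
      · simp [iteratedDeriv_one, hd]
    rw [hord1] at hle
    norm_num at hle
  have hL : (fderiv ℝ (A k) 0 ∘L .inr ℝ E ℝ) 1 = deriv (fun s : ℝ => A k (0, s)) 0 := by
    have h1 : HasFDerivAt (A k) (fderiv ℝ (A k) 0) ((0 : E), (0 : ℝ)) :=
      (hA k).differentiableAt.hasFDerivAt
    have h2 : HasDerivAt (fun s : ℝ => ((0 : E), s)) ((0 : E), (1 : ℝ)) 0 :=
      (hasDerivAt_const 0 (0 : E)).prodMk (hasDerivAt_id (0 : ℝ))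
    exact (h1.comp_hasDerivAt (0 : ℝ) h2).deriv.symm
  have hinv : (fderiv ℝ (A k) 0 ∘L .inr ℝ E ℝ).IsInvertible := by
    refine ⟨ContinuousLinearEquiv.unitsEquivAut ℝ (Units.mk0 _ hh1), ?_⟩
    ext
    simp only [ContinuousLinearEquiv.coe_coe, ContinuousLinearEquiv.unitsEquivAut_apply,
      Units.val_mk0, one_mul]
    exact hL.symm
  have hcd : ContDiffAt ℝ ⊤ (A k) (0 : E × ℝ) := (hA k).contDiffAt
  set φ := hcd.implicitFunction (by simp) hinv
  have hφan : AnalyticAt ℝ φ 0 := (hcd.contDiffAt_implicitFunction (by simp) hinv).analyticAt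
  have hφ0 : φ 0 = 0 := hcd.implicitFunction_apply_self (by simp) hinv
  have hφz : ∀ᶠ x in 𝓝 (0 : E), A k (x, φ x) = 0 := by
    have := hcd.eventually_apply_implicitFunction (by simp) hinv
    rwa [hh0] at this
  have hσ' : AnalyticAt ℝ (fun z : E × ℝ => ((z.1, φ z.1), z.2)) 0 := by
    have h1 : AnalyticAt ℝ (fun z : E × ℝ => φ z.1) 0 :=
      AnalyticAt.fun_comp (f := Prod.fst) (x := (0 : E × ℝ)) hφan analyticAt_fst
    exact (analyticAt_fst.prod h1).prod analyticAt_snd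
  have hσ'0 : ((((0 : E × ℝ).1, φ (0 : E × ℝ).1), (0 : E × ℝ).2) : (E × ℝ) × ℝ) = 0 := by
    simp [hφ0]
  have hF' : AnalyticAt ℝ (fun z : E × ℝ => f (z.1, φ z.1 + z.2)) 0 :=
    AnalyticAt.fun_comp (g := fun w : (E × ℝ) × ℝ => f (w.1.1, w.1.2 + w.2))
      (f := fun z : E × ℝ => ((z.1, φ z.1), z.2)) (by rw [hσ'0]; exact hF) hσ'
  have hu' : AnalyticAt ℝ (fun z : E × ℝ => u ((z.1, φ z.1), z.2)) 0 :=
    AnalyticAt.fun_comp (f := fun z : E × ℝ => ((z.1, φ z.1), z.2)) (by rw [hσ'0]; exact hu) hσ'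
  have hexp' : ∀ᶠ z : E × ℝ in 𝓝 0, f (z.1, φ z.1 + z.2) =
      ∑ i ∈ Finset.range (k + 1), A i (z.1, φ z.1) * z.2 ^ i +
        z.2 ^ (k + 1) * u ((z.1, φ z.1), z.2) := by
    have ht := hσ'.continuousAt.tendsto
    rw [hσ'0] at ht
    exact ht.eventually hexp
  have hat := expansion_at_zero (a := fun i x => A i (x, φ x)) hF' hu' hexp'
    (by simpa [hφ0] using ho)
  refine ⟨φ, fun i x => A i (x, φ x), _, hφan, hφ0, fun i => ?_, hu',
    fun i hi => hat.1 i (by omega), hat.2, ?_⟩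
  · exact AnalyticAt.fun_comp (f := fun x => (x, φ x))
      (by rw [hφ0]; exact hA i) (analyticAt_id.prod hφan)
  · filter_upwards [hexp', continuousAt_fst.eventually hφz] with z hz hz'
    rw [hz, Finset.sum_range_succ, hz']
    simp

end Expansion

/-- `f` is, near the origin, the product of a monomial and an analytic unit. -/
def IsMonomialGerm {n : ℕ} (f : (Fin n → ℝ) → ℝ) : Prop :=
  ∃ (α : Fin n → ℕ) (h : (Fin n → ℝ) → ℝ), AnalyticAt ℝ h 0 ∧ h 0 ≠ 0 ∧
    ∀ᶠ x in 𝓝 0, f x = (∏ i, x i ^ α i) * h x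

theorem analyticAt_coord {n : ℕ} (i : Fin n) (z : Fin n → ℝ) :
    AnalyticAt ℝ (fun x : Fin n → ℝ => x i) z :=
  (ContinuousLinearMap.proj (R := ℝ) (φ := fun _ : Fin n => ℝ) i).analyticAt z

theorem analyticAt_monomial {n : ℕ} (α : Fin n → ℕ) (z : Fin n → ℝ) :
    AnalyticAt ℝ (fun x : Fin n → ℝ => ∏ i, x i ^ α i) z :=
  Finset.analyticAt_fun_prod _ fun i _ => (analyticAt_coord i z).fun_pow _

theorem not_eventually_coord_eq_zero {n : ℕ} (i : Fin n) :
    ¬ ∀ᶠ x : Fin n → ℝ in 𝓝 0, x i = 0 := by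
  intro h
  have ht : Tendsto (fun t : ℝ => (fun _ : Fin n => t)) (𝓝[≠] 0) (𝓝 0) :=
    ((continuous_pi fun _ => continuous_id).tendsto' (0 : ℝ) (0 : Fin n → ℝ) rfl).mono_left
      nhdsWithin_le_nhds
  obtain ⟨t, h1, h2⟩ := ((ht.eventually h).and self_mem_nhdsWithin).exists
  exact h2 h1

theorem exists_monomial_eq_coord_mul {n : ℕ} {α : Fin n → ℕ} {i : Fin n} (hi : 0 < α i) :
    ∃ β : Fin n → ℕ, ∑ j, α j = ∑ j, β j + 1 ∧
      ∀ x : Fin n → ℝ, ∏ j, x j ^ α j = x i * ∏ j, x j ^ β j := by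
  set β : Fin n → ℕ := Function.update α i (α i - 1) with hβ
  have h4 : β i = α i - 1 := by simp [hβ]
  have h5 : ∀ j ∈ Finset.univ.erase i, β j = α j := fun j hj => by
    rw [hβ, Function.update_of_ne (Finset.ne_of_mem_erase hj)]
  refine ⟨β, ?_, fun x => ?_⟩
  · have h1 := Finset.add_sum_erase Finset.univ α (Finset.mem_univ i)
    have h2 := Finset.add_sum_erase Finset.univ β (Finset.mem_univ i)
    have h3 : ∑ j ∈ Finset.univ.erase i, β j = ∑ j ∈ Finset.univ.erase i, α j :=
      Finset.sum_congr rfl h5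
    omega
  · rw [← Finset.mul_prod_erase _ _ (Finset.mem_univ i),
      ← Finset.mul_prod_erase (s := Finset.univ) (fun j => x j ^ β j) (Finset.mem_univ i)]
    have h3 : ∏ j ∈ Finset.univ.erase i, x j ^ β j = ∏ j ∈ Finset.univ.erase i, x j ^ α j :=
      Finset.prod_congr rfl fun j hj => by rw [h5 j hj]
    rw [h3, h4, ← mul_assoc, ← pow_succ', Nat.sub_add_cancel hi]

namespace IsMonomialGerm

variable {n : ℕ} {f g : (Fin n → ℝ) → ℝ}

theorem congr (hf : IsMonomialGerm f) (h : ∀ᶠ x in 𝓝 0, f x = g x) : IsMonomialGerm g := by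
  obtain ⟨α, u, hu, hu0, hfu⟩ := hf
  exact ⟨α, u, hu, hu0, by filter_upwards [h, hfu] with x h1 h2; rw [← h1, h2]⟩

theorem of_ne_zero (hf : AnalyticAt ℝ f 0) (h : f 0 ≠ 0) : IsMonomialGerm f :=
  ⟨0, f, hf, h, by simp⟩

theorem coord (i : Fin n) : IsMonomialGerm (fun x : Fin n → ℝ => x i) :=
  ⟨Pi.single i 1, fun _ => 1, analyticAt_const, one_ne_zero, Eventually.of_forall fun x => by
    rw [Finset.prod_eq_single i (fun j _ hj => by simp [hj]) (by simp)]; simp⟩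

theorem mul (hf : IsMonomialGerm f) (hg : IsMonomialGerm g) :
    IsMonomialGerm (fun x => f x * g x) := by
  obtain ⟨α, u, hu, hu0, hfu⟩ := hf
  obtain ⟨β, v, hv, hv0, hgv⟩ := hg
  refine ⟨α + β, fun x => u x * v x, hu.fun_mul hv, mul_ne_zero hu0 hv0, ?_⟩
  filter_upwards [hfu, hgv] with x h1 h2
  rw [h1, h2]
  simp only [Pi.add_apply, pow_add, Finset.prod_mul_distrib]
  ring

theorem prod {ι : Type*} (s : Finset ι) {F : ι → (Fin n → ℝ) → ℝ}
    (h : ∀ i ∈ s, IsMonomialGerm (F i)) : IsMonomialGerm (fun x => ∏ i ∈ s, F i x) := by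
  classical
  induction s using Finset.induction_on with
  | empty => simpa using of_ne_zero (f := fun _ => 1) analyticAt_const one_ne_zero
  | insert a s ha ih =>
    simp only [Finset.prod_insert ha]
    exact (h a (by simp)).mul (ih fun i hi => h i (by simp [hi]))

theorem pow (hf : IsMonomialGerm f) (k : ℕ) : IsMonomialGerm (fun x => f x ^ k) := by
  simpa using prod (Finset.range k) (F := fun _ => f) fun _ _ => hf

theorem analyticAt (hf : IsMonomialGerm f) : AnalyticAt ℝ f 0 := by
  obtain ⟨α, u, hu, -, hfu⟩ := hf
  exact ((analyticAt_monomial α 0).fun_mul hu).congr (by filter_upwards [hfu] with x hx; rw [hx])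

theorem not_eventually_eq_zero (hf : IsMonomialGerm f) : ¬ ∀ᶠ x in 𝓝 0, f x = 0 := by
  obtain ⟨α, u, hu, hu0, hfu⟩ := hf
  intro h
  have ht : Tendsto (fun t : ℝ => (fun _ : Fin n => t)) (𝓝[≠] 0) (𝓝 0) :=
    ((continuous_pi fun _ => continuous_id).tendsto' (0 : ℝ) (0 : Fin n → ℝ) rfl).mono_left
      nhdsWithin_le_nhds
  obtain ⟨t, ⟨h1, h2, h3⟩, h4⟩ := ((ht.eventually
    (h.and (hfu.and (hu.continuousAt.eventually_ne hu0)))).and self_mem_nhdsWithin).exists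
  rw [h1] at h2
  exact mul_ne_zero (Finset.prod_ne_zero_iff.2 fun i _ => pow_ne_zero _ h4) h3 h2.symm

theorem of_mul_left (hf : AnalyticAt ℝ f 0) (hg : AnalyticAt ℝ g 0)
    (h : IsMonomialGerm fun x => f x * g x) : IsMonomialGerm f := by
  obtain ⟨α, u, hu, hu0, hfu⟩ := h
  induction hs : ∑ i, α i generalizing α f g with
  | zero =>
    have hα : ∀ i, α i = 0 := by simpa using hs
    refine of_ne_zero hf fun h0 => hu0 ?_
    have := hfu.self_of_nhds
    simpa [hα, h0] using this.symm
  | succ k ih =>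
    obtain ⟨i, hi⟩ : ∃ i, 0 < α i := by
      by_contra! hc
      have : ∑ i, α i = 0 := Finset.sum_eq_zero fun i _ => Nat.le_zero.1 (hc i)
      omega
    obtain ⟨β, hsum, hprod⟩ := exists_monomial_eq_coord_mul hi
    set l : (Fin n → ℝ) →L[ℝ] ℝ := ContinuousLinearMap.proj i with hl
    set Q : (Fin n → ℝ) →L[ℝ] (Fin n → ℝ) :=
      ContinuousLinearMap.id ℝ _ - l.smulRight (Pi.single i 1) with hQ
    have hQ0 : ∀ x, Q x i = 0 := fun x => by simp [hQ, hl]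
    have hQt : Tendsto Q (𝓝 0) (𝓝 0) := Q.continuous.tendsto' 0 0 (map_zero Q)
    have hQx : ∀ x : Fin n → ℝ, l x = 0 → Q x = x := fun x hx => by simp [hQ, hx]
    have hfQ : AnalyticAt ℝ (fun x => f (Q x)) 0 :=
      AnalyticAt.fun_comp (by rw [map_zero]; exact hf) (Q.analyticAt 0)
    have hgQ : AnalyticAt ℝ (fun x => g (Q x)) 0 :=
      AnalyticAt.fun_comp (by rw [map_zero]; exact hg) (Q.analyticAt 0)
    have hdiv : ∀ F : (Fin n → ℝ) → ℝ, AnalyticAt ℝ F 0 → (∀ᶠ x in 𝓝 0, F (Q x) = 0) →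
        ∃ G, AnalyticAt ℝ G 0 ∧ ∀ᶠ x in 𝓝 0, F x = x i * G x := fun F hF h0 =>
      AnalyticAt.exists_eq_mul_of_vanishing l (Pi.single i 1) (by simp [hl]) hF (by
        filter_upwards [h0] with x hx hlx
        rwa [hQx x hlx] at hx)
    have hcancel : ∀ F : (Fin n → ℝ) → ℝ, AnalyticAt ℝ F 0 →
        (∀ᶠ x in 𝓝 0, f x * g x = x i * F x) →
        ∀ᶠ x in 𝓝 0, F x = (∏ j, x j ^ β j) * u x := by
      intro F hF h
      have := AnalyticAt.eventually_eq_zero_or_eq_zero_of_mul (analyticAt_coord i 0)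
        (hF.fun_sub ((analyticAt_monomial β 0).fun_mul hu)) (by
          filter_upwards [h, hfu] with x h1 h2
          rw [h1, hprod] at h2
          linear_combination h2)
      filter_upwards [this.resolve_left (not_eventually_coord_eq_zero i)] with x hx
      exact sub_eq_zero.1 hx
    rcases AnalyticAt.eventually_eq_zero_or_eq_zero_of_mul hfQ hgQ (by
        filter_upwards [hQt.eventually hfu] with x hx
        rw [hx, hprod, hQ0]; simp) with h0 | h0
    · obtain ⟨f', hf', hff'⟩ := hdiv f hf h0
      refine ((coord i).mul (ih hf' hg β (hcancel _ (hf'.fun_mul hg) ?_) (by omega))).congr ?_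
      · filter_upwards [hff'] with x hx; rw [hx, mul_assoc]
      · filter_upwards [hff'] with x hx; rw [hx]
    · obtain ⟨g', hg', hgg'⟩ := hdiv g hg h0
      refine ih hf hg' β (hcancel _ (hf.fun_mul hg') ?_) (by omega)
      filter_upwards [hgg'] with x hx; rw [hx]; ring

theorem of_mul_right (hf : AnalyticAt ℝ f 0) (hg : AnalyticAt ℝ g 0)
    (h : IsMonomialGerm fun x => f x * g x) : IsMonomialGerm g :=
  of_mul_left hg hf (h.congr (by simp [mul_comm]))

theorem of_prod {ι : Type*} {s : Finset ι} {F : ι → (Fin n → ℝ) → ℝ}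
    (hF : ∀ i ∈ s, AnalyticAt ℝ (F i) 0) (h : IsMonomialGerm fun x => ∏ i ∈ s, F i x) {i : ι}
    (hi : i ∈ s) : IsMonomialGerm (F i) := by
  classical
  refine of_mul_left (g := fun x => ∏ j ∈ s.erase i, F j x) (hF i hi)
    (Finset.analyticAt_fun_prod _ fun j hj => hF j (Finset.mem_of_mem_erase hj)) ?_
  refine h.congr (Eventually.of_forall fun x => ?_)
  exact (Finset.mul_prod_erase s (fun j => F j x) hi).symm

theorem comp {N : ℕ} (hf : IsMonomialGerm f) {π : (Fin N → ℝ) → Fin n → ℝ}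
    (hπ : AnalyticAt ℝ π 0) (h0 : π 0 = 0) (hπm : ∀ j, IsMonomialGerm fun x => π x j) :
    IsMonomialGerm fun x => f (π x) := by
  obtain ⟨α, u, hu, hu0, hfu⟩ := hf
  have ht : Tendsto π (𝓝 0) (𝓝 0) := by simpa [h0] using hπ.continuousAt.tendsto
  have h1 : IsMonomialGerm fun x => u (π x) :=
    of_ne_zero (AnalyticAt.fun_comp (by rwa [h0]) hπ) (by rwa [h0])
  refine ((prod Finset.univ fun i _ => (hπm i).pow (α i)).mul h1).congr ?_
  filter_upwards [ht.eventually hfu] with x hx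
  rw [hx]

end IsMonomialGerm

theorem not_eventually_monomial_sub_vanishing {n : ℕ} {α β : Fin n → ℕ}
    {a b : (Fin n → ℝ) → ℝ} (ha : AnalyticAt ℝ a 0) (ha0 : a 0 ≠ 0) {i k : Fin n} (hi : α i = 0)
    (hi' : β i ≠ 0) (hk : α k = 0) :
    ¬ ∀ᶠ x : Fin n → ℝ in 𝓝 0, x k = 0 → (∏ j, x j ^ α j) * a x - (∏ j, x j ^ β j) * b x = 0 := by
  intro h
  have ht : Tendsto (fun t : ℝ => (fun l : Fin n => if l = k ∨ l = i then 0 else t)) (𝓝[≠] 0)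
      (𝓝 0) := by
    refine Tendsto.mono_left (Continuous.tendsto' (continuous_pi fun l => ?_) _ _ ?_)
      nhdsWithin_le_nhds
    · split_ifs <;> fun_prop
    · ext l; simp
  obtain ⟨t, ⟨h1, h2⟩, h4⟩ := ((ht.eventually
    (h.and (ha.continuousAt.eventually_ne ha0))).and self_mem_nhdsWithin).exists
  have h3 := h1 (by simp)
  rw [Finset.prod_eq_zero (f := fun j : Fin n => _ ^ β j) (Finset.mem_univ i) (by simp [hi']),
    zero_mul, sub_zero] at h3
  refine mul_ne_zero (Finset.prod_ne_zero_iff.2 fun l _ => ?_) h2 h3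
  by_cases hl : l = k ∨ l = i
  · rcases hl with rfl | rfl <;> simp [hi, hk]
  · simp only [if_neg hl]; exact pow_ne_zero _ h4

/-- If the difference of two monomial germs is zero or a monomial germ, then one of the two
monomials divides the other. -/
theorem monomial_comparable {n : ℕ} {α β : Fin n → ℕ}
    {a b : (Fin n → ℝ) → ℝ} (ha : AnalyticAt ℝ a 0) (ha0 : a 0 ≠ 0) (hb : AnalyticAt ℝ b 0)
    (hb0 : b 0 ≠ 0)
    (h : (∀ᶠ x : Fin n → ℝ in 𝓝 0, (∏ j, x j ^ α j) * a x - (∏ j, x j ^ β j) * b x = 0) ∨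
      IsMonomialGerm fun x => (∏ j, x j ^ α j) * a x - (∏ j, x j ^ β j) * b x) :
    α ≤ β ∨ β ≤ α := by
  by_contra! hc
  obtain ⟨hαβ, hβα⟩ := hc
  obtain ⟨j, hj⟩ : ∃ j, β j < α j := by simpa [Pi.le_def] using hαβ
  obtain ⟨i, hi⟩ : ∃ i, α i < β i := by simpa [Pi.le_def] using hβα
  set μ := α ⊓ β
  set α' : Fin n → ℕ := fun l => α l - μ l with hα'
  set β' : Fin n → ℕ := fun l => β l - μ l with hβ'
  have hμα : ∀ l, α' l = 0 ∨ β' l = 0 := fun l => by simp [hα', hβ', μ]; omega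
  have hfac : ∀ x : Fin n → ℝ, (∏ j, x j ^ α j) * a x - (∏ j, x j ^ β j) * b x =
      (∏ j, x j ^ μ j) * ((∏ j, x j ^ α' j) * a x - (∏ j, x j ^ β' j) * b x) := by
    intro x
    have h1 : ∏ j, x j ^ α j = (∏ j, x j ^ μ j) * ∏ j, x j ^ α' j := by
      rw [← Finset.prod_mul_distrib]
      exact Finset.prod_congr rfl fun l _ => by
        rw [← pow_add]; congr 1; simp [hα', μ]
    have h2 : ∏ j, x j ^ β j = (∏ j, x j ^ μ j) * ∏ j, x j ^ β' j := by
      rw [← Finset.prod_mul_distrib]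
      exact Finset.prod_congr rfl fun l _ => by
        rw [← pow_add]; congr 1; simp [hβ', μ]
    rw [h1, h2]; ring
  have hi1 : α' i = 0 := by simp [hα', μ]; omega
  have hi2 : β' i ≠ 0 := by simp [hβ', μ]; omega
  have hj1 : β' j = 0 := by simp [hβ', μ]; omega
  have hj2 : α' j ≠ 0 := by simp [hα', μ]; omega
  set D : (Fin n → ℝ) → ℝ := fun x => (∏ j, x j ^ α' j) * a x - (∏ j, x j ^ β' j) * b x with hD
  have hDan : AnalyticAt ℝ D 0 :=
    ((analyticAt_monomial α' 0).fun_mul ha).fun_sub ((analyticAt_monomial β' 0).fun_mul hb)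
  have hμm : IsMonomialGerm fun x : Fin n → ℝ => ∏ j, x j ^ μ j :=
    .prod _ fun j _ => (IsMonomialGerm.coord j).pow _
  obtain ⟨k, hk⟩ : ∃ k, ∀ᶠ x in 𝓝 0, x k = 0 → D x = 0 := by
    simp only [hfac] at h
    rcases h with h | h
    · refine ⟨i, ?_⟩
      filter_upwards [(AnalyticAt.eventually_eq_zero_or_eq_zero_of_mul hμm.analyticAt hDan
        h).resolve_left hμm.not_eventually_eq_zero] with x hx _ using hx
    · obtain ⟨δ, c, hc, hc0, hDc⟩ := IsMonomialGerm.of_mul_right hμm.analyticAt hDan h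
      have hD0 : D 0 = 0 := by
        simp only [hD]
        rw [Finset.prod_eq_zero (Finset.mem_univ j) (by simp [hj2]),
          Finset.prod_eq_zero (Finset.mem_univ i) (by simp [hi2])]
        simp
      have h0 := hDc.self_of_nhds
      rw [hD0, eq_comm, mul_eq_zero, or_iff_left hc0, Finset.prod_eq_zero_iff] at h0
      obtain ⟨k, -, hk⟩ := h0
      refine ⟨k, ?_⟩
      filter_upwards [hDc] with x hx hxk
      have hδk : δ k ≠ 0 := fun h => by simp [h] at hk
      rw [hx, Finset.prod_eq_zero (Finset.mem_univ k) (by simp [hxk, hδk]), zero_mul]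
  rcases hμα k with hk' | hk'
  · exact not_eventually_monomial_sub_vanishing (b := b) ha ha0 hi1 hi2 hk' hk
  · refine not_eventually_monomial_sub_vanishing (b := a) hb hb0 hj1 hj2 hk' ?_
    filter_upwards [hk] with x hx hxk
    rw [← neg_sub, neg_eq_zero]
    exact hx hxk

/-- `g` becomes a monomial germ after an analytic substitution through which the ultrafilter `𝓕`,
converging to the origin, can be lifted. -/
def IsMonomializable (N : ℕ) {V : Type*} [NormedAddCommGroup V] [NormedSpace ℝ V]
    (𝓕 : Ultrafilter V) (g : V → ℝ) : Prop :=
  ∃ (π : (Fin N → ℝ) → V) (𝓖 : Ultrafilter (Fin N → ℝ)), AnalyticAt ℝ π 0 ∧ π 0 = 0 ∧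
    (𝓖 : Filter (Fin N → ℝ)) ≤ 𝓝 0 ∧ 𝓖.map π = 𝓕 ∧ IsMonomialGerm fun x => g (π x)

theorem AnalyticAt.tendsto_zero {V W : Type*} [NormedAddCommGroup V] [NormedSpace ℝ V]
    [NormedAddCommGroup W] [NormedSpace ℝ W] {π : V → W} (h : AnalyticAt ℝ π 0) (h0 : π 0 = 0) :
    Tendsto π (𝓝 0) (𝓝 0) := by
  simpa [h0] using h.continuousAt.tendsto

theorem IsMonomializable.of_comp {N : ℕ} {V W : Type*} [NormedAddCommGroup V] [NormedSpace ℝ V]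
    [NormedAddCommGroup W] [NormedSpace ℝ W] {𝓕 : Ultrafilter V} {𝓕₁ : Ultrafilter W} {g : V → ℝ}
    {ψ : W → V} (hψ : AnalyticAt ℝ ψ 0) (hψ0 : ψ 0 = 0) (hm : 𝓕₁.map ψ = 𝓕)
    (h : IsMonomializable N 𝓕₁ fun w => g (ψ w)) : IsMonomializable N 𝓕 g := by
  obtain ⟨π, 𝓖, hπ, hπ0, h𝓖, hmap, hmon⟩ := h
  refine ⟨fun x => ψ (π x), 𝓖, AnalyticAt.fun_comp (by rwa [hπ0]) hπ, by simp [hπ0, hψ0], h𝓖, ?_,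
    hmon⟩
  rw [← hm, ← hmap, Ultrafilter.map_map]
  rfl

section Fibration

variable {n : ℕ}

/-- The splitting of `ℝⁿ⁺¹` as `ℝⁿ × ℝ`. -/
def splitChart (n : ℕ) : (Fin (n + 1) → ℝ) →L[ℝ] (Fin n → ℝ) × ℝ :=
  (ContinuousLinearMap.pi fun j : Fin n => ContinuousLinearMap.proj j.succ).prod
    (ContinuousLinearMap.proj 0)

theorem exists_splitChart_lift {𝓕 : Ultrafilter ((Fin n → ℝ) × ℝ)}
    (h𝓕 : (𝓕 : Filter ((Fin n → ℝ) × ℝ)) ≤ 𝓝 0) : ∃ 𝓖 : Ultrafilter (Fin (n + 1) → ℝ),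
      (𝓖 : Filter (Fin (n + 1) → ℝ)) ≤ 𝓝 0 ∧ 𝓖.map (splitChart n) = 𝓕 := by
  refine ⟨𝓕.map fun z => Fin.cons z.2 z.1, ?_, ?_⟩
  · have hc : Continuous fun z : (Fin n → ℝ) × ℝ => (Fin.cons z.2 z.1 : Fin (n + 1) → ℝ) := by
      refine continuous_pi fun i => ?_
      refine Fin.cases ?_ (fun j => ?_) i
      · simpa using continuous_snd
      · simp only [Fin.cons_succ]; fun_prop
    refine le_trans (map_mono h𝓕) (hc.tendsto' _ _ ?_)
    ext i
    refine Fin.cases ?_ (fun j => ?_) i <;> simp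
  · rw [Ultrafilter.map_map]
    exact Ultrafilter.map_id 𝓕

theorem isMonomializable_of_splitChart {𝓕 : Ultrafilter ((Fin n → ℝ) × ℝ)}
    (h𝓕 : (𝓕 : Filter ((Fin n → ℝ) × ℝ)) ≤ 𝓝 0) {g : (Fin n → ℝ) × ℝ → ℝ}
    (h : IsMonomialGerm fun x => g (splitChart n x)) : IsMonomializable (n + 1) 𝓕 g := by
  obtain ⟨𝓖, h1, h2⟩ := exists_splitChart_lift h𝓕
  exact ⟨splitChart n, 𝓖, (splitChart n).analyticAt 0, map_zero _, h1, h2, h⟩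

theorem IsMonomialGerm.splitChart_fst (j : Fin n) :
    IsMonomialGerm fun x => (splitChart n x).1 j :=
  IsMonomialGerm.coord j.succ

theorem IsMonomialGerm.splitChart_snd :
    IsMonomialGerm fun x => (splitChart n x).2 :=
  IsMonomialGerm.coord 0

theorem analyticAt_fst_coord (j : Fin n) (z : (Fin n → ℝ) × ℝ) :
    AnalyticAt ℝ (fun z : (Fin n → ℝ) × ℝ => z.1 j) z :=
  (ContinuousLinearMap.proj (R := ℝ) (φ := fun _ : Fin n => ℝ) j ∘L
    ContinuousLinearMap.fst ℝ (Fin n → ℝ) ℝ).analyticAt z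

/-- Compatibility of monomialization with a substitution fibred over the first factor. -/
theorem IsMonomializable.of_fibration {𝓕 𝓕₁ : Ultrafilter ((Fin n → ℝ) × ℝ)}
    {f g : (Fin n → ℝ) × ℝ → ℝ} {ψ : (Fin n → ℝ) × ℝ → (Fin n → ℝ) × ℝ}
    {μ : Fin n → (Fin n → ℝ) → ℝ} {m : (Fin n → ℝ) → ℝ}
    (hψ : AnalyticAt ℝ ψ 0) (hψ0 : ψ 0 = 0) (hmap : 𝓕₁.map ψ = 𝓕) (hg : AnalyticAt ℝ g 0)
    (hμ : ∀ j, IsMonomialGerm (μ j)) (hψμ : ∀ j, ∀ᶠ z in 𝓝 0, (ψ z).1 j = μ j z.1)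
    (hm : IsMonomialGerm m) (hfg : ∀ᶠ z in 𝓝 0, f (ψ z) = m z.1 * g z)
    (h : IsMonomializable (n + 1) 𝓕₁ fun z => g z * ∏ j, z.1 j) :
    IsMonomializable (n + 1) 𝓕 fun z => f z * ∏ j, z.1 j := by
  refine .of_comp hψ hψ0 hmap ?_
  obtain ⟨π, 𝓖, hπ, hπ0, h𝓖, hmap', hmon⟩ := h
  refine ⟨π, 𝓖, hπ, hπ0, h𝓖, hmap', ?_⟩
  have hgπ : AnalyticAt ℝ (fun x => g (π x)) 0 := AnalyticAt.fun_comp (by rwa [hπ0]) hπ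
  have hjπ : ∀ j, AnalyticAt ℝ (fun x => (π x).1 j) 0 := fun j =>
    AnalyticAt.fun_comp (g := fun z : (Fin n → ℝ) × ℝ => z.1 j) (analyticAt_fst_coord j _) hπ
  have hPπ : AnalyticAt ℝ (fun x => ∏ j, (π x).1 j) 0 :=
    Finset.analyticAt_fun_prod _ fun j _ => hjπ j
  have h1 := IsMonomialGerm.of_mul_left hgπ hPπ hmon
  have h2 : ∀ j, IsMonomialGerm fun x => (π x).1 j := fun j =>
    IsMonomialGerm.of_prod (fun j _ => hjπ j) (IsMonomialGerm.of_mul_right hgπ hPπ hmon)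
      (Finset.mem_univ j)
  have hπ1 : AnalyticAt ℝ (fun x => (π x).1) 0 :=
    AnalyticAt.fun_comp (g := Prod.fst) analyticAt_fst hπ
  have h3 : ∀ {F : (Fin n → ℝ) → ℝ}, IsMonomialGerm F → IsMonomialGerm fun x => F (π x).1 :=
    fun hF => hF.comp hπ1 (by simp [hπ0]) h2
  refine (((h3 hm).mul h1).mul (IsMonomialGerm.prod Finset.univ fun j _ => h3 (hμ j))).congr ?_
  have ht := hπ.tendsto_zero hπ0
  filter_upwards [ht.eventually hfg, ht.eventually (eventually_all.2 hψμ)] with x hx hx'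
  rw [hx]
  simp only [hx']

/-- Base change of an ultrafilter along a map of the first factor. -/
theorem Ultrafilter.exists_lift_prodMap {α β γ : Type*} {ψ : α → β} {𝓕 : Ultrafilter (β × γ)}
    {𝓖 : Ultrafilter α} (h : 𝓖.map ψ = 𝓕.map Prod.fst) :
    ∃ 𝓗 : Ultrafilter (α × γ), 𝓗.map (fun z => (ψ z.1, z.2)) = 𝓕 ∧ 𝓗.map Prod.fst = 𝓖 := by
  have hne : NeBot (Filter.comap (fun z : α × γ => (ψ z.1, z.2)) 𝓕 ⊓ Filter.comap Prod.fst 𝓖) := by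
    rw [Filter.inf_neBot_iff]
    rintro s ⟨S, hS, hSs⟩ t ⟨T, hT, hTt⟩
    have h1 : ψ '' T ∈ 𝓖.map ψ := by
      rw [Ultrafilter.mem_map]
      exact mem_of_superset hT (Set.subset_preimage_image ψ T)
    rw [h, Ultrafilter.mem_map] at h1
    obtain ⟨z, hz, a, ha, haz⟩ := 𝓕.nonempty_of_mem (inter_mem hS h1)
    exact ⟨(a, z.2), hSs (by simpa [haz] using hz), hTt (by simpa using ha)⟩
  obtain ⟨𝓗, h𝓗⟩ := Ultrafilter.exists_le (f := Filter.comap (fun z : α × γ => (ψ z.1, z.2)) 𝓕 ⊓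
    Filter.comap Prod.fst 𝓖)
  refine ⟨𝓗, ?_, ?_⟩
  · exact Ultrafilter.coe_le_coe.1 (tendsto_iff_comap.2 (h𝓗.trans inf_le_left))
  · exact Ultrafilter.coe_le_coe.1 (tendsto_iff_comap.2 (h𝓗.trans inf_le_right))

/-- An ultrafilter converging to the origin lifts through a substitution `v ↦ (± vᵢᴺ)ᵢ`. -/
theorem Ultrafilter.exists_lift_signed_pow {N : ℕ} (hN : N ≠ 0) {𝓕 : Ultrafilter (Fin n → ℝ)}
    (h𝓕 : (𝓕 : Filter (Fin n → ℝ)) ≤ 𝓝 0) :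
    ∃ (ε : Fin n → ℝ) (𝓖 : Ultrafilter (Fin n → ℝ)), (∀ j, ε j ≠ 0) ∧
      (𝓖 : Filter (Fin n → ℝ)) ≤ 𝓝 0 ∧ 𝓖.map (fun v j => ε j * v j ^ N) = 𝓕 := by
  have hsgn : ∀ j, ∃ ε : ℝ, ε ≠ 0 ∧ ∀ᶠ x : Fin n → ℝ in 𝓕, ε * |x j| = x j := by
    intro j
    rcases 𝓕.em (fun x => 0 ≤ x j) with h | h
    · exact ⟨1, one_ne_zero, h.mono fun x hx => by rw [one_mul, abs_of_nonneg hx]⟩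
    · exact ⟨-1, by norm_num, h.mono fun x hx => by
        rw [abs_of_nonpos (not_le.1 hx).le]; ring⟩
  choose ε hε hεx using hsgn
  refine ⟨ε, 𝓕.map fun x j => |x j| ^ ((N : ℝ)⁻¹), hε, ?_, ?_⟩
  · have hc : Continuous fun x : Fin n → ℝ => fun j => |x j| ^ ((N : ℝ)⁻¹) :=
      continuous_pi fun j => (continuous_apply j).abs.rpow_const fun x => Or.inr (by positivity)
    refine le_trans (map_mono h𝓕) (hc.tendsto' _ _ ?_)
    ext j
    simp [hN]
  · rw [Ultrafilter.map_map]
    have : ((fun v : Fin n → ℝ => fun j => ε j * v j ^ N) ∘ fun x j => |x j| ^ ((N : ℝ)⁻¹))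
        =ᶠ[𝓕] id := by
      filter_upwards [eventually_all.2 hεx] with x hx
      ext j
      simp only [Function.comp, id, Real.rpow_inv_natCast_pow (abs_nonneg (x j)) hN]
      exact hx j
    apply Ultrafilter.coe_injective
    rw [Ultrafilter.coe_map, Filter.map_congr this, Filter.map_id]

/-- A ratio bounded along an ultrafilter converges along it. -/
theorem Ultrafilter.exists_tendsto_div_of_le {α : Type*} {𝓕 : Ultrafilter α} {a b : α → ℝ} {C : ℝ}
    (h : ∀ᶠ z in 𝓕, |a z| ≤ C * |b z|) :
    ∃ c, Tendsto (fun z => a z / b z) 𝓕 (𝓝 c) ∧ ∀ᶠ z in 𝓕, a z = b z * (a z / b z) := by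
  have hmem : ∀ᶠ z in 𝓕, a z / b z ∈ Set.Icc (-|C|) |C| := by
    filter_upwards [h] with z hz
    rw [Set.mem_Icc, ← abs_le, abs_div]
    refine div_le_of_le_mul₀ (abs_nonneg _) (abs_nonneg _) (hz.trans ?_)
    gcongr
    exact le_abs_self C
  obtain ⟨c, -, hc⟩ := isCompact_Icc.ultrafilter_le_nhds (𝓕.map fun z => a z / b z)
    (le_principal_iff.2 hmem)
  refine ⟨c, hc, ?_⟩
  filter_upwards [h] with z hz
  rcases eq_or_ne (b z) 0 with hb | hb
  · simpa [hb] using hz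
  · field_simp

end Fibration

section Monomialization

variable {n : ℕ}

theorem analyticAt_fst_comp {h : (Fin n → ℝ) → ℝ} (hh : AnalyticAt ℝ h 0) :
    AnalyticAt ℝ (fun z : (Fin n → ℝ) × ℝ => h z.1) 0 :=
  AnalyticAt.fun_comp (f := Prod.fst) (x := (0 : (Fin n → ℝ) × ℝ)) hh analyticAt_fst

theorem ultrafilter_map_snd_le {𝓕 : Ultrafilter ((Fin n → ℝ) × ℝ)}
    (h𝓕 : (𝓕 : Filter ((Fin n → ℝ) × ℝ)) ≤ 𝓝 0) {w : (Fin n → ℝ) × ℝ → ℝ}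
    (hw : Tendsto w 𝓕 (𝓝 0)) :
    (𝓕.map (fun z => (z.1, w z)) : Filter ((Fin n → ℝ) × ℝ)) ≤ 𝓝 0 := by
  have h1 : Tendsto (fun z : (Fin n → ℝ) × ℝ => z.1) 𝓕 (𝓝 0) :=
    (continuous_fst.tendsto' (0 : (Fin n → ℝ) × ℝ) 0 rfl).mono_left h𝓕
  exact h1.prodMk_nhds hw

theorem Ultrafilter.map_map_eq_of_eventually {α β : Type*} {𝓕 : Ultrafilter α} {f : α → β}
    {g : β → α} (h : g ∘ f =ᶠ[𝓕] id) : (𝓕.map f).map g = 𝓕 := by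
  rw [Ultrafilter.map_map]
  apply Ultrafilter.coe_injective
  rw [Ultrafilter.coe_map, Filter.map_congr h, Filter.map_id]

/-- If the last variable dominates a monomial in the others along `𝓕`, then after a suitable
substitution it divides this monomial. -/
theorem exists_substitution_of_dominated {γ : Fin n → ℕ} {𝓕 : Ultrafilter ((Fin n → ℝ) × ℝ)}
    (h𝓕 : (𝓕 : Filter ((Fin n → ℝ) × ℝ)) ≤ 𝓝 0)
    (hdom : ∀ C : ℝ, ∀ᶠ z : (Fin n → ℝ) × ℝ in 𝓕, C * |∏ j, z.1 j ^ γ j| < |z.2|) :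
    ∃ (π : (Fin (n + 1) → ℝ) → (Fin n → ℝ) × ℝ) (𝓖 : Ultrafilter (Fin (n + 1) → ℝ))
      (q : (Fin (n + 1) → ℝ) → ℝ), AnalyticAt ℝ π 0 ∧ π 0 = 0 ∧
      (𝓖 : Filter (Fin (n + 1) → ℝ)) ≤ 𝓝 0 ∧ 𝓖.map π = 𝓕 ∧
      (∀ j, IsMonomialGerm fun x => (π x).1 j) ∧ (IsMonomialGerm fun x => (π x).2) ∧
      AnalyticAt ℝ q 0 ∧ q 0 = 0 ∧ ∀ᶠ x in 𝓝 0, ∏ j, (π x).1 j ^ γ j = (π x).2 * q x := by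
  induction hs : ∑ j, γ j generalizing γ 𝓕 with
  | zero =>
    exfalso
    have hγ : ∀ j, γ j = 0 := by simpa using hs
    have h1 : ∀ᶠ z : (Fin n → ℝ) × ℝ in 𝓝 0, |z.2| < 1 :=
      (by fun_prop : Continuous fun z : (Fin n → ℝ) × ℝ => |z.2|).tendsto' 0 0 (by simp)
        |>.eventually_lt_const one_pos
    obtain ⟨z, hz, hz'⟩ := ((hdom 1).and (h𝓕 h1)).exists
    simp only [hγ, pow_zero, Finset.prod_const_one, abs_one, mul_one] at hz
    exact lt_asymm hz hz'
  | succ s ih =>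
    obtain ⟨j, hj⟩ : ∃ j, 0 < γ j := by
      by_contra! hc
      have : ∑ j, γ j = 0 := Finset.sum_eq_zero fun j _ => Nat.le_zero.1 (hc j)
      omega
    obtain ⟨β, hsum, hprod⟩ := exists_monomial_eq_coord_mul hj
    by_cases hcase : ∃ C : ℝ, ∀ᶠ z : (Fin n → ℝ) × ℝ in 𝓕, |z.2| ≤ C * |z.1 j|
    · obtain ⟨C, hC⟩ := hcase
      obtain ⟨c, hc, hdiv⟩ := Ultrafilter.exists_tendsto_div_of_le
        (a := fun z : (Fin n → ℝ) × ℝ => z.2) (b := fun z => z.1 j) hC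
      set ψ : (Fin n → ℝ) × ℝ → (Fin n → ℝ) × ℝ := fun z => (z.1, z.1 j * (c + z.2)) with hψ
      have hψan : ∀ z, AnalyticAt ℝ ψ z := fun z =>
        analyticAt_fst.prod ((analyticAt_fst_coord j z).fun_mul
          (analyticAt_const.fun_add analyticAt_snd))
      have hψ0 : ψ 0 = 0 := by simp [hψ]
      set 𝓕₁ := 𝓕.map fun z => (z.1, z.2 / z.1 j - c) with h𝓕₁def
      have h𝓕₁ : (𝓕₁ : Filter ((Fin n → ℝ) × ℝ)) ≤ 𝓝 0 :=
        ultrafilter_map_snd_le h𝓕 (by simpa using hc.sub_const c)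
      have hmap : 𝓕₁.map ψ = 𝓕 := Ultrafilter.map_map_eq_of_eventually (by
        filter_upwards [hdiv] with z hz
        refine Prod.ext rfl ?_
        change z.1 j * (c + (z.2 / z.1 j - c)) = z.2
        rw [add_sub_cancel, ← hz])
      rcases eq_or_ne c 0 with rfl | hc0
      · obtain ⟨π, 𝓖, q, hπ, hπ0, h𝓖, hmap', hπ1, hπ2, hq, hq0, hqe⟩ := ih h𝓕₁ (fun D => by
          rw [h𝓕₁def, Ultrafilter.coe_map, eventually_map]
          filter_upwards [hdiv, hdom D] with z hz hz'
          rw [hprod, abs_mul] at hz'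
          rw [hz, abs_mul] at hz'
          have : D * |∏ l, z.1 l ^ β l| < |z.2 / z.1 j| := by
            by_contra! hcon
            have := mul_le_mul_of_nonneg_left hcon (abs_nonneg (z.1 j))
            linarith
          simpa using this) (show ∑ l, β l = s by omega)
        refine ⟨fun x => ψ (π x), 𝓖, q, AnalyticAt.fun_comp (hψan _) hπ, by simp [hπ0, hψ0], h𝓖,
          ?_, hπ1, ?_, hq, hq0, ?_⟩
        · rw [← hmap, ← hmap', Ultrafilter.map_map]; rfl
        · simpa [hψ] using (hπ1 j).mul hπ2
        · filter_upwards [hqe] with x hx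
          simp only [hψ, hprod, hx, zero_add]
          ring
      · obtain ⟨𝓖, h𝓖, hmap'⟩ := exists_splitChart_lift h𝓕₁
        have hun : AnalyticAt ℝ (fun x => c + (splitChart n x).2) 0 :=
          analyticAt_const.fun_add IsMonomialGerm.splitChart_snd.analyticAt
        have hun0 : c + (splitChart n 0).2 ≠ 0 := by simpa using hc0
        have hβan : AnalyticAt ℝ (fun x => ∏ l, (splitChart n x).1 l ^ β l) 0 :=
          Finset.analyticAt_fun_prod _ fun l _ =>
            (IsMonomialGerm.splitChart_fst l).analyticAt.fun_pow _
        refine ⟨fun x => ψ (splitChart n x), 𝓖,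
          fun x => (∏ l, (splitChart n x).1 l ^ β l) * (c + (splitChart n x).2)⁻¹,
          AnalyticAt.fun_comp (hψan _) ((splitChart n).analyticAt 0), by simp [hψ0], h𝓖, ?_,
          IsMonomialGerm.splitChart_fst,
          (IsMonomialGerm.splitChart_fst j).mul (.of_ne_zero hun hun0),
          hβan.fun_mul (hun.fun_inv hun0), ?_, ?_⟩
        · rw [← hmap, ← hmap', Ultrafilter.map_map]; rfl
        · by_contra hne
          have hβ : ∀ l, β l = 0 := by
            intro l
            by_contra hl
            refine hne ?_
            exact mul_eq_zero_of_left (Finset.prod_eq_zero (Finset.mem_univ l) (by simp [hl])) _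
          obtain ⟨z, hz, hz'⟩ := (hC.and (hdom C)).exists
          simp only [hprod, hβ, pow_zero, Finset.prod_const_one, mul_one] at hz'
          linarith
        · filter_upwards [hun.continuousAt.eventually_ne hun0] with x hx
          simp only [hψ, hprod]
          field_simp
    · push Not at hcase
      set ψ : (Fin n → ℝ) × ℝ → (Fin n → ℝ) × ℝ :=
        fun z => (Function.update z.1 j (z.2 * z.1 j), z.2) with hψ
      have hψan : ∀ z, AnalyticAt ℝ ψ z := by
        refine fun z => AnalyticAt.prod ?_ analyticAt_snd
        refine analyticAt_pi_iff.2 fun l => ?_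
        rcases eq_or_ne l j with rfl | hl
        · simpa using analyticAt_snd.fun_mul (analyticAt_fst_coord l z)
        · simpa [hl] using analyticAt_fst_coord l z
      have hψ0 : ψ 0 = 0 := by simp [hψ]
      have hne : ∀ᶠ z : (Fin n → ℝ) × ℝ in 𝓕, z.2 ≠ 0 :=
        (hdom 0).mono fun z hz => by simpa using hz
      have hw : Tendsto (fun z : (Fin n → ℝ) × ℝ => z.1 j / z.2) 𝓕 (𝓝 0) := by
        rw [Metric.tendsto_nhds]
        intro ε hε
        filter_upwards [hcase ε⁻¹, hne] with z hz hz0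
        rw [dist_zero_right, Real.norm_eq_abs, abs_div, div_lt_iff₀ (abs_pos.2 hz0)]
        rwa [inv_mul_lt_iff₀ hε] at hz
      set 𝓕₁ := 𝓕.map fun z => (Function.update z.1 j (z.1 j / z.2), z.2) with h𝓕₁def
      have h𝓕₁ : (𝓕₁ : Filter ((Fin n → ℝ) × ℝ)) ≤ 𝓝 0 := by
        have h2 : Tendsto (fun z : (Fin n → ℝ) × ℝ => z.2) 𝓕 (𝓝 0) :=
          (continuous_snd.tendsto' (0 : (Fin n → ℝ) × ℝ) 0 rfl).mono_left h𝓕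
        refine Tendsto.prodMk_nhds (tendsto_pi_nhds.2 fun l => ?_) h2
        rcases eq_or_ne l j with rfl | hl
        · simpa using hw
        · simpa [hl] using ((by fun_prop : Continuous fun z : (Fin n → ℝ) × ℝ => z.1 l).tendsto'
            0 0 rfl).mono_left h𝓕
      have hmap : 𝓕₁.map ψ = 𝓕 := Ultrafilter.map_map_eq_of_eventually (by
        filter_upwards [hne] with z hz
        simp [hψ, mul_div_cancel₀ _ hz])
      obtain ⟨𝓖, h𝓖, hmap'⟩ := exists_splitChart_lift h𝓕₁
      have hmon : ∀ l, IsMonomialGerm fun x => (ψ (splitChart n x)).1 l := by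
        intro l
        rcases eq_or_ne l j with rfl | hl
        · simpa [hψ] using
            IsMonomialGerm.splitChart_snd.mul (IsMonomialGerm.splitChart_fst l)
        · simpa [hψ, hl] using IsMonomialGerm.splitChart_fst l
      refine ⟨fun x => ψ (splitChart n x), 𝓖,
        fun x => (splitChart n x).1 j * ∏ l, (ψ (splitChart n x)).1 l ^ β l,
        AnalyticAt.fun_comp (hψan _) ((splitChart n).analyticAt 0), by simp [hψ0], h𝓖, ?_,
        hmon, IsMonomialGerm.splitChart_snd, ?_, by simp, Eventually.of_forall fun x => ?_⟩
      · rw [← hmap, ← hmap', Ultrafilter.map_map]; rfl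
      · exact (IsMonomialGerm.splitChart_fst j).analyticAt.fun_mul
          (Finset.analyticAt_fun_prod _ fun l _ => (hmon l).analyticAt.fun_pow _)
      · rw [hprod]
        simp [hψ, mul_assoc]

theorem not_eventually_prod_eq_zero {V ι : Type*} [NormedAddCommGroup V] [NormedSpace ℝ V]
    {s : Finset ι} {F : ι → V → ℝ} (hF : ∀ i ∈ s, AnalyticAt ℝ (F i) 0)
    (h : ∀ i ∈ s, ¬ ∀ᶠ x in 𝓝 0, F i x = 0) : ¬ ∀ᶠ x in 𝓝 0, ∏ i ∈ s, F i x = 0 := by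
  classical
  induction s using Finset.induction_on with
  | empty => simpa using (nhds_neBot (x := (0 : V))).ne
  | insert a s ha ih =>
    intro h0
    simp only [Finset.prod_insert ha] at h0
    rcases AnalyticAt.eventually_eq_zero_or_eq_zero_of_mul (hF a (by simp))
      (Finset.analyticAt_fun_prod _ fun j hj => hF j (by simp [hj])) h0 with h1 | h1
    · exact h a (by simp) h1
    · exact ih (fun i hi => hF i (by simp [hi])) (fun i hi => h i (by simp [hi])) h1

theorem exists_simultaneous_monomialization {ι : Type*} {s : Finset ι}
    {F : ι → (Fin n → ℝ) → ℝ} {𝓕 : Ultrafilter (Fin n → ℝ)}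
    (hM : ∀ f : (Fin n → ℝ) → ℝ, AnalyticAt ℝ f 0 → (¬ ∀ᶠ x in 𝓝 0, f x = 0) →
      IsMonomializable n 𝓕 f)
    (hF : ∀ i ∈ s, AnalyticAt ℝ (F i) 0) (h : ∀ i ∈ s, ¬ ∀ᶠ x in 𝓝 0, F i x = 0) :
    ∃ (π : (Fin n → ℝ) → Fin n → ℝ) (𝓖 : Ultrafilter (Fin n → ℝ)), AnalyticAt ℝ π 0 ∧ π 0 = 0 ∧
      (𝓖 : Filter (Fin n → ℝ)) ≤ 𝓝 0 ∧ 𝓖.map π = 𝓕 ∧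
      (∀ i ∈ s, IsMonomialGerm fun x => F i (π x)) ∧ ∀ j, IsMonomialGerm fun x => π x j := by
  have han1 : AnalyticAt ℝ (fun x => ∏ i ∈ s, F i x) 0 := Finset.analyticAt_fun_prod _ hF
  have han2 : AnalyticAt ℝ (fun x : Fin n → ℝ => ∏ j, x j) 0 :=
    Finset.analyticAt_fun_prod _ fun j _ => analyticAt_coord j 0
  obtain ⟨π, 𝓖, hπ, hπ0, h𝓖, hmap, hmon⟩ := hM (fun x => (∏ i ∈ s, F i x) * ∏ j, x j)
    (han1.fun_mul han2) (by
      intro h0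
      rcases AnalyticAt.eventually_eq_zero_or_eq_zero_of_mul han1 han2 h0 with h' | h'
      · exact not_eventually_prod_eq_zero hF h h'
      · exact not_eventually_prod_eq_zero (s := Finset.univ) (F := fun j (x : Fin n → ℝ) => x j)
          (fun j _ => analyticAt_coord j 0) (fun j _ => not_eventually_coord_eq_zero j) h')
  have hcomp : ∀ {G : (Fin n → ℝ) → ℝ}, AnalyticAt ℝ G 0 → AnalyticAt ℝ (fun x => G (π x)) 0 :=
    fun hG => AnalyticAt.fun_comp (by rwa [hπ0]) hπ
  refine ⟨π, 𝓖, hπ, hπ0, h𝓖, hmap, fun i hi => ?_, fun j => ?_⟩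
  · exact IsMonomialGerm.of_prod (F := fun i x => F i (π x)) (fun i hi => hcomp (hF i hi))
      (IsMonomialGerm.of_mul_left (hcomp han1) (hcomp han2) hmon) hi
  · exact IsMonomialGerm.of_prod (F := fun j x => π x j) (fun j _ => hcomp (analyticAt_coord j 0))
      (IsMonomialGerm.of_mul_right (hcomp han1) (hcomp han2) hmon) (Finset.mem_univ j)

/-- Finitely many germs on `ℝⁿ` vanishing at the origin can be made divisible by the appropriate
powers of a common nontrivial monomial, in a sharp way. -/
theorem exists_common_monomial {k : ℕ} {a : ℕ → (Fin n → ℝ) → ℝ}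
    {𝓕 : Ultrafilter (Fin n → ℝ)}
    (hM : ∀ f : (Fin n → ℝ) → ℝ, AnalyticAt ℝ f 0 → (¬ ∀ᶠ x in 𝓝 0, f x = 0) →
      IsMonomializable n 𝓕 f)
    (ha : ∀ i, AnalyticAt ℝ (a i) 0) (ha0 : ∀ i < k, a i 0 = 0)
    (hne : ∃ i < k, ¬ ∀ᶠ x in 𝓝 0, a i x = 0) :
    ∃ (ψ : (Fin n → ℝ) → Fin n → ℝ) (𝓖 : Ultrafilter (Fin n → ℝ)) (γ : Fin n → ℕ)
      (e : ℕ → (Fin n → ℝ) → ℝ), AnalyticAt ℝ ψ 0 ∧ ψ 0 = 0 ∧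
      (𝓖 : Filter (Fin n → ℝ)) ≤ 𝓝 0 ∧ 𝓖.map ψ = 𝓕 ∧ (∀ j, IsMonomialGerm fun x => ψ x j) ∧
      (∃ j, γ j ≠ 0) ∧ (∀ i, AnalyticAt ℝ (e i) 0) ∧ (∃ i < k, e i 0 ≠ 0) ∧
      ∀ i < k, ∀ᶠ x in 𝓝 0, a i (ψ x) = e i x * (∏ j, x j ^ γ j) ^ (k + 1 - i) := by
  classical
  set N := (k + 1).factorial
  have hN0 : N ≠ 0 := Nat.factorial_ne_zero _
  set r : ℕ → ℕ := fun i => N / (k + 1 - i)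
  have hr : ∀ i < k, r i * (k + 1 - i) = N := fun i hi =>
    Nat.div_mul_cancel (Nat.dvd_factorial (by omega) (by omega))
  set I := (Finset.range k).filter fun i => ¬ ∀ᶠ x in 𝓝 0, a i x = 0 with hI
  have hIk : ∀ i ∈ I, i < k := fun i hi => by simp [hI] at hi; exact hi.1
  have hInz : ∀ i ∈ I, ¬ ∀ᶠ x in 𝓝 0, a i x = 0 := fun i hi => (Finset.mem_filter.1 hi).2
  set b : ℕ → (Fin n → ℝ) → ℝ := fun i x => a i x ^ r i with hb
  have hban : ∀ i, AnalyticAt ℝ (b i) 0 := fun i => (ha i).fun_pow _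
  set J := (I ×ˢ I).filter fun p => ¬ ∀ᶠ x in 𝓝 0, b p.1 x - b p.2 x = 0
  obtain ⟨π, 𝓖', hπ, hπ0, h𝓖', hmap', hmon, hX⟩ := exists_simultaneous_monomialization
    (s := I.disjSum J) (F := Sum.elim a fun p x => b p.1 x - b p.2 x) hM (by
      rintro (i | p) -
      exacts [ha i, (hban p.1).fun_sub (hban p.2)]) (by
      rintro (i | p) hip
      · exact hInz i (Finset.inl_mem_disjSum.1 hip)
      · exact (Finset.mem_filter.1 (Finset.inr_mem_disjSum.1 hip)).2)
  have hA : ∀ i ∈ I, IsMonomialGerm fun x => a i (π x) := fun i hi =>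
    hmon (Sum.inl i) (Finset.inl_mem_disjSum.2 hi)
  have hB : ∀ p ∈ J, IsMonomialGerm fun x => b p.1 (π x) - b p.2 (π x) := fun p hp =>
    hmon (Sum.inr p) (Finset.inr_mem_disjSum.2 hp)
  choose! α h hh hh0 hαh using hA
  set β : ℕ → Fin n → ℕ := fun i j => r i * α i j with hβ
  have hbe : ∀ i ∈ I, ∀ᶠ x in 𝓝 0, b i (π x) = (∏ j, x j ^ β i j) * h i x ^ r i := by
    intro i hi
    filter_upwards [hαh i hi] with x hx
    simp only [hb, hx, mul_pow, ← Finset.prod_pow, ← pow_mul, hβ, mul_comm (r i)]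
  have hcmp : ∀ i ∈ I, ∀ i' ∈ I, β i ≤ β i' ∨ β i' ≤ β i := by
    intro i hi i' hi'
    refine monomial_comparable (a := fun x => h i x ^ r i) (b := fun x => h i' x ^ r i')
      ((hh i hi).fun_pow _) (pow_ne_zero _ (hh0 i hi)) ((hh i' hi').fun_pow _)
      (pow_ne_zero _ (hh0 i' hi')) ?_
    by_cases hz : ∀ᶠ x in 𝓝 0, b i x - b i' x = 0
    · left
      filter_upwards [(hπ.tendsto_zero hπ0).eventually hz, hbe i hi, hbe i' hi'] with x h1 h2 h3
      rw [← h2, ← h3, h1]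
    · right
      refine (hB (i, i') (Finset.mem_filter.2 ⟨Finset.mk_mem_product hi hi', hz⟩)).congr ?_
      filter_upwards [hbe i hi, hbe i' hi'] with x h2 h3
      rw [← h2, ← h3]
  have hIne : I.Nonempty := by
    obtain ⟨i, hi, hi'⟩ := hne
    exact ⟨i, Finset.mem_filter.2 ⟨Finset.mem_range.2 hi, hi'⟩⟩
  obtain ⟨i₀, hi₀, hmin⟩ := Finset.exists_minimalFor β I hIne
  have hleast : ∀ i ∈ I, β i₀ ≤ β i := fun i hi =>
    (hcmp i₀ hi₀ i hi).elim id fun h => hmin hi h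
  obtain ⟨ε, 𝓖, hε, h𝓖, hmap⟩ := Ultrafilter.exists_lift_signed_pow hN0 h𝓖'
  set σ : (Fin n → ℝ) → Fin n → ℝ := fun v j => ε j * v j ^ N with hσ
  have hσan : AnalyticAt ℝ σ 0 := analyticAt_pi_iff.2 fun j =>
    analyticAt_const.fun_mul ((analyticAt_coord j 0).fun_pow _)
  have hσ0 : σ 0 = 0 := by ext j; simp [hσ, hN0]
  have hσm : ∀ j, IsMonomialGerm fun v => σ v j := fun j =>
    (IsMonomialGerm.of_ne_zero analyticAt_const (hε j)).mul ((IsMonomialGerm.coord j).pow _)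
  have hψan : AnalyticAt ℝ (fun v => π (σ v)) 0 := AnalyticAt.fun_comp (by rwa [hσ0]) hσan
  have hψ0 : π (σ 0) = 0 := by rw [hσ0, hπ0]
  refine ⟨fun v => π (σ v), 𝓖, β i₀, fun i v => if i ∈ I then
    (∏ j, v j ^ (β i j - β i₀ j)) ^ (k + 1 - i) * (∏ j, ε j ^ α i j) * h i (σ v) else 0,
    hψan, hψ0, h𝓖, ?_,
    fun j => (hX j).comp hσan hσ0 hσm, ?_, fun i => ?_, ⟨i₀, hIk i₀ hi₀, ?_⟩, fun i hi => ?_⟩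
  · rw [← hmap', ← hmap, Ultrafilter.map_map]; rfl
  · by_contra! hc
    have h1 := (hαh i₀ hi₀).self_of_nhds
    change a i₀ (π 0) = _ at h1
    rw [hπ0, ha0 i₀ (hIk i₀ hi₀), eq_comm] at h1
    refine mul_ne_zero (Finset.prod_ne_zero_iff.2 fun j _ => ?_) (hh0 i₀ hi₀) h1
    have h2 : α i₀ j = 0 := by
      refine (mul_eq_zero.1 (hc j)).resolve_left fun h => hN0 ?_
      rw [← hr i₀ (hIk i₀ hi₀), h, zero_mul]
    simp [h2]
  · by_cases hi : i ∈ I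
    · simp only [if_pos hi]
      exact (((analyticAt_monomial _ 0).fun_pow _).fun_mul analyticAt_const).fun_mul
        (AnalyticAt.fun_comp (by rw [hσ0]; exact hh i hi) hσan)
    · simpa only [if_neg hi] using analyticAt_const
  · simp only [if_pos hi₀, hσ0]
    refine mul_ne_zero (mul_ne_zero (by simp) ?_) (hh0 i₀ hi₀)
    exact Finset.prod_ne_zero_iff.2 fun j _ => pow_ne_zero _ (hε j)
  · by_cases hiI : i ∈ I
    · filter_upwards [(hσan.tendsto_zero hσ0).eventually (hαh i hiI)] with v hv
      rw [if_pos hiI, hv]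
      have h1 : ∏ j, σ v j ^ α i j = (∏ j, ε j ^ α i j) * (∏ j, v j ^ β i j) ^ (k + 1 - i) := by
        rw [← Finset.prod_pow, ← Finset.prod_mul_distrib]
        refine Finset.prod_congr rfl fun j _ => ?_
        rw [hσ, mul_pow, ← pow_mul, ← pow_mul, ← hr i hi]
        congr 2
        simp only [hβ]; ring
      have h2 : ∏ j, v j ^ β i j = (∏ j, v j ^ (β i j - β i₀ j)) * ∏ j, v j ^ β i₀ j := by
        rw [← Finset.prod_mul_distrib]
        refine Finset.prod_congr rfl fun j _ => ?_
        rw [← pow_add, Nat.sub_add_cancel (hleast i hiI j)]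
      rw [h1, h2, mul_pow]
      ring
    · have hz : ∀ᶠ x in 𝓝 0, a i x = 0 := by
        by_contra hz
        exact hiI (Finset.mem_filter.2 ⟨Finset.mem_range.2 hi, hz⟩)
      filter_upwards [(hψan.tendsto_zero hψ0).eventually hz] with v hv
      rw [if_neg hiI, hv, zero_mul]

theorem analyticOrderAt_translate_lt {k : ℕ} {e : ℕ → ℝ} {c w : ℝ} (hw : w ≠ 0)
    (he : ∃ i < k, e i ≠ 0) :
    analyticOrderAt (fun t : ℝ => ∑ i ∈ Finset.range k, e i * (c + t) ^ i + (c + t) ^ (k + 1) * w)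
      0 < (k + 1 : ℕ) := by
  by_contra! hle
  set G : ℝ → ℝ := fun t => ∑ i ∈ Finset.range k, e i * (c + t) ^ i + (c + t) ^ (k + 1) * w with hG
  have hGan : AnalyticAt ℝ G 0 := by simp only [hG]; fun_prop
  have hzero := (natCast_le_analyticOrderAt_iff_iteratedDeriv_eq_zero hGan).1 hle
  set P : Polynomial ℝ := ∑ i ∈ Finset.range k, Polynomial.C (e i) *
    (Polynomial.X + Polynomial.C c) ^ i + Polynomial.C w * (Polynomial.X + Polynomial.C c) ^ (k + 1)
    with hP
  have heval : ∀ t, G t = P.eval t := fun t => by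
    simp [hG, hP, Polynomial.eval_finsetSum, add_comm c, mul_comm w]
  have hdeg : P.natDegree < k + 2 := by
    refine Nat.lt_succ_of_le (Polynomial.natDegree_add_le_of_degree_le ?_ ?_)
    · refine Polynomial.natDegree_sum_le_of_forall_le _ _ fun i hi => ?_
      refine (Polynomial.natDegree_C_mul_le _ _).trans ?_
      rw [Polynomial.natDegree_pow_X_add_C]
      exact (Finset.mem_range.1 hi).le.trans (Nat.le_succ k)
    · exact (Polynomial.natDegree_C_mul_le _ _).trans (Polynomial.natDegree_pow_X_add_C _ _).le
  have hcoeff : ∀ i < k + 1, P.coeff i = 0 := by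
    intro i hi
    have h1 := iteratedDeriv_of_eventuallyEq_sum_add (G := G) (v := fun _ => 0) (c := P.coeff)
      (N := k + 2) analyticAt_const (Eventually.of_forall fun y => by
        rw [heval, Polynomial.eval_eq_sum_range' hdeg]; simp) (show i < k + 2 by omega)
    rw [hzero i hi] at h1
    exact (mul_eq_zero.1 h1.symm).resolve_left (by positivity)
  have hc : c = 0 := by
    have h1 := hcoeff k (Nat.lt_succ_self k)
    rw [hP, Polynomial.coeff_add, Polynomial.finsetSum_coeff, Finset.sum_eq_zero, zero_add,
      Polynomial.coeff_C_mul, Polynomial.coeff_X_add_C_pow] at h1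
    · have hk : c = 0 ∨ (k : ℝ) + 1 = 0 := by simpa [hw] using h1
      exact hk.resolve_right (by positivity)
    · intro i hi
      refine Polynomial.coeff_eq_zero_of_natDegree_lt
        ((Polynomial.natDegree_C_mul_le _ _).trans_lt ?_)
      rw [Polynomial.natDegree_pow_X_add_C]
      exact Finset.mem_range.1 hi
  obtain ⟨i, hi, hei⟩ := he
  have h1 := iteratedDeriv_of_eventuallyEq_sum_add (G := G) (v := fun y => y * w) (c := e)
    (N := k) (by fun_prop) (Eventually.of_forall fun y => by simp only [hG, hc, zero_add]; ring) hi
  rw [hzero i (by omega)] at h1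
  exact hei ((mul_eq_zero.1 h1.symm).resolve_left (by positivity))

/-- The inductive step of monomialization in the presence of a common monomial. -/
theorem isMonomializable_of_common_monomial {k : ℕ} {f u : (Fin n → ℝ) × ℝ → ℝ}
    {e : ℕ → (Fin n → ℝ) → ℝ} {γ : Fin n → ℕ} {𝓕 : Ultrafilter ((Fin n → ℝ) × ℝ)}
    (h𝓕 : (𝓕 : Filter ((Fin n → ℝ) × ℝ)) ≤ 𝓝 0)
    (ih : ∀ d < k + 1, ∀ g : (Fin n → ℝ) × ℝ → ℝ, AnalyticAt ℝ g 0 →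
      analyticOrderAt (fun t => g (0, t)) 0 = d → ∀ 𝓕₁ : Ultrafilter ((Fin n → ℝ) × ℝ),
      (𝓕₁ : Filter ((Fin n → ℝ) × ℝ)) ≤ 𝓝 0 →
      IsMonomializable (n + 1) 𝓕₁ fun z => g z * ∏ j, z.1 j)
    (he : ∀ i, AnalyticAt ℝ (e i) 0) (he0 : ∃ i < k, e i 0 ≠ 0) (hγ : ∃ j, γ j ≠ 0)
    (hu : AnalyticAt ℝ u 0) (hu0 : u 0 ≠ 0)
    (hf : ∀ᶠ z : (Fin n → ℝ) × ℝ in 𝓝 0, f z = ∑ i ∈ Finset.range k,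
      e i z.1 * (∏ j, z.1 j ^ γ j) ^ (k + 1 - i) * z.2 ^ i + z.2 ^ (k + 1) * u z) :
    IsMonomializable (n + 1) 𝓕 fun z => f z * ∏ j, z.1 j := by
  by_cases hcase : ∃ C : ℝ, ∀ᶠ z : (Fin n → ℝ) × ℝ in 𝓕, |z.2| ≤ C * |∏ j, z.1 j ^ γ j|
  · obtain ⟨C, hC⟩ := hcase
    obtain ⟨c, hc, hdiv⟩ := Ultrafilter.exists_tendsto_div_of_le
      (a := fun z : (Fin n → ℝ) × ℝ => z.2) (b := fun z => ∏ j, z.1 j ^ γ j) hC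
    set m : (Fin n → ℝ) → ℝ := fun x => ∏ j, x j ^ γ j
    have hm0 : m 0 = 0 := by
      obtain ⟨j, hj⟩ := hγ
      exact Finset.prod_eq_zero (Finset.mem_univ j) (by simp [hj])
    have hmm : IsMonomialGerm m := .prod _ fun j _ => (IsMonomialGerm.coord j).pow _
    have hman : AnalyticAt ℝ (fun z : (Fin n → ℝ) × ℝ => m z.1) 0 :=
      analyticAt_fst_comp hmm.analyticAt
    have hcan : AnalyticAt ℝ (fun z : (Fin n → ℝ) × ℝ => c + z.2) 0 :=
      analyticAt_const.fun_add analyticAt_snd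
    set ψ : (Fin n → ℝ) × ℝ → (Fin n → ℝ) × ℝ := fun z => (z.1, m z.1 * (c + z.2)) with hψ
    have hψan : AnalyticAt ℝ ψ 0 := analyticAt_fst.prod (hman.fun_mul hcan)
    have hψ0 : ∀ t, ψ (0, t) = 0 := by simp [hψ, hm0]
    have hψ00 : ψ 0 = 0 := hψ0 0
    set 𝓕₁ := 𝓕.map fun z => (z.1, z.2 / m z.1 - c)
    have h𝓕₁ : (𝓕₁ : Filter ((Fin n → ℝ) × ℝ)) ≤ 𝓝 0 :=
      ultrafilter_map_snd_le h𝓕 (by simpa using hc.sub_const c)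
    have hmap : 𝓕₁.map ψ = 𝓕 := Ultrafilter.map_map_eq_of_eventually (by
      filter_upwards [hdiv] with z hz
      refine Prod.ext rfl ?_
      change m z.1 * (c + (z.2 / m z.1 - c)) = z.2
      rw [add_sub_cancel, ← hz])
    set g : (Fin n → ℝ) × ℝ → ℝ := fun z =>
      ∑ i ∈ Finset.range k, e i z.1 * (c + z.2) ^ i + (c + z.2) ^ (k + 1) * u (ψ z) with hg
    have hgan : AnalyticAt ℝ g 0 := by
      refine (Finset.analyticAt_fun_sum _ fun i _ =>
        (analyticAt_fst_comp (he i)).fun_mul (hcan.fun_pow _)).fun_add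
        ((hcan.fun_pow _).fun_mul (AnalyticAt.fun_comp (by rwa [hψ00]) hψan))
    have hord : analyticOrderAt (fun t => g (0, t)) 0 < (k + 1 : ℕ) := by
      simp only [hg, hψ0]
      exact analyticOrderAt_translate_lt (e := fun i => e i 0) hu0 he0
    obtain ⟨d, hd⟩ := ENat.ne_top_iff_exists.1 (ne_top_of_lt hord)
    refine IsMonomializable.of_fibration hψan hψ00 hmap hgan (fun j => IsMonomialGerm.coord j)
      (fun j => Eventually.of_forall fun z => rfl) (hmm.pow (k + 1)) ?_
      (ih d (by rw [← hd] at hord; exact_mod_cast hord) g hgan hd.symm 𝓕₁ h𝓕₁)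
    filter_upwards [(hψan.tendsto_zero hψ00).eventually hf] with z hz
    rw [hz]
    change ∑ i ∈ Finset.range k, e i z.1 * m z.1 ^ (k + 1 - i) * (m z.1 * (c + z.2)) ^ i +
      (m z.1 * (c + z.2)) ^ (k + 1) * u (ψ z) = m z.1 ^ (k + 1) *
      (∑ i ∈ Finset.range k, e i z.1 * (c + z.2) ^ i + (c + z.2) ^ (k + 1) * u (ψ z))
    rw [mul_add (m z.1 ^ (k + 1)), Finset.mul_sum]
    congr 1
    · refine Finset.sum_congr rfl fun i hi => ?_
      have hik : k + 1 - i + i = k + 1 := Nat.sub_add_cancel (by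
        have := Finset.mem_range.1 hi; omega)
      rw [← hik, mul_pow, pow_add, Nat.add_sub_cancel]
      ring
    · rw [mul_pow]; ring
  · push Not at hcase
    obtain ⟨π, 𝓖, q, hπ, hπ0, h𝓖, hmap, hπ1, hπ2, hq, hq0, hqe⟩ :=
      exists_substitution_of_dominated h𝓕 hcase
    refine ⟨π, 𝓖, hπ, hπ0, h𝓖, hmap, ?_⟩
    set w : (Fin (n + 1) → ℝ) → ℝ := fun x =>
      ∑ i ∈ Finset.range k, e i (π x).1 * q x ^ (k + 1 - i) + u (π x) with hw
    have hπ1an : AnalyticAt ℝ (fun x => (π x).1) 0 :=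
      AnalyticAt.fun_comp (g := Prod.fst) analyticAt_fst hπ
    have hwan : AnalyticAt ℝ w 0 :=
      (Finset.analyticAt_fun_sum _ fun i _ => (AnalyticAt.fun_comp
        (by rw [hπ0]; exact he i) hπ1an).fun_mul (hq.fun_pow _)).fun_add
        (AnalyticAt.fun_comp (by rwa [hπ0]) hπ)
    have hw0 : w 0 ≠ 0 := by
      rw [hw]
      simp only [hq0, hπ0]
      rwa [Finset.sum_eq_zero, zero_add]
      intro i hi
      rw [zero_pow (by have := Finset.mem_range.1 hi; omega), mul_zero]
    refine (((hπ2.pow (k + 1)).mul (.of_ne_zero hwan hw0)).mul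
      (IsMonomialGerm.prod Finset.univ fun j _ => hπ1 j)).congr ?_
    filter_upwards [(hπ.tendsto_zero hπ0).eventually hf, hqe] with x hx hx'
    rw [hx, hw, hx', mul_add, Finset.mul_sum]
    congr 2
    refine Finset.sum_congr rfl fun i hi => ?_
    have hik : k + 1 - i + i = k + 1 := Nat.sub_add_cancel (by
      have := Finset.mem_range.1 hi; omega)
    rw [← hik, mul_pow, pow_add, Nat.add_sub_cancel]
    ring

theorem isMonomializable_mul_prod_of_order
    (hM : ∀ 𝓕 : Ultrafilter (Fin n → ℝ), (𝓕 : Filter (Fin n → ℝ)) ≤ 𝓝 0 →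
      ∀ f : (Fin n → ℝ) → ℝ, AnalyticAt ℝ f 0 → (¬ ∀ᶠ x in 𝓝 0, f x = 0) →
      IsMonomializable n 𝓕 f) (d : ℕ) :
    ∀ f : (Fin n → ℝ) × ℝ → ℝ, AnalyticAt ℝ f 0 → analyticOrderAt (fun t => f (0, t)) 0 = d →
      ∀ 𝓕 : Ultrafilter ((Fin n → ℝ) × ℝ), (𝓕 : Filter ((Fin n → ℝ) × ℝ)) ≤ 𝓝 0 →
      IsMonomializable (n + 1) 𝓕 fun z => f z * ∏ j, z.1 j := by
  induction d using Nat.strong_induction_on with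
  | _ d ih =>
  intro f hf hd 𝓕 h𝓕
  have hsplit : AnalyticAt ℝ (splitChart n) 0 := (splitChart n).analyticAt 0
  have hcomp : ∀ {u : (Fin n → ℝ) × ℝ → ℝ}, AnalyticAt ℝ u 0 → u 0 ≠ 0 →
      IsMonomialGerm fun x => u (splitChart n x) := fun hu hu0 =>
    .of_ne_zero (AnalyticAt.fun_comp (by rwa [map_zero]) hsplit) (by rwa [map_zero])
  have hprod : IsMonomialGerm fun x => ∏ j, (splitChart n x).1 j :=
    .prod _ fun j _ => .splitChart_fst j
  rcases d with _ | k
  · refine isMonomializable_of_splitChart h𝓕 ((hcomp hf ?_).mul hprod)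
    have hf' : AnalyticAt ℝ (fun t : ℝ => f (0, t)) 0 :=
      AnalyticAt.fun_comp (g := f) hf (analyticAt_const.prod analyticAt_id)
    exact hf'.analyticOrderAt_eq_zero.1 hd
  obtain ⟨φ, a, u, hφ, hφ0, ha, hu, ha0, hu0, hfe⟩ := hf.exists_tschirnhaus k hd
  set ψ : (Fin n → ℝ) × ℝ → (Fin n → ℝ) × ℝ := fun z => (z.1, φ z.1 + z.2) with hψdef
  have hψ : AnalyticAt ℝ ψ 0 :=
    analyticAt_fst.prod ((analyticAt_fst_comp hφ).fun_add analyticAt_snd)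
  have hψ0 : ψ 0 = 0 := by simp [hψdef, hφ0]
  set 𝓕₁ := 𝓕.map fun z => (z.1, z.2 - φ z.1)
  have h𝓕₁ : (𝓕₁ : Filter ((Fin n → ℝ) × ℝ)) ≤ 𝓝 0 := by
    have hχ : AnalyticAt ℝ (fun z : (Fin n → ℝ) × ℝ => (z.1, z.2 - φ z.1)) 0 :=
      analyticAt_fst.prod (analyticAt_snd.fun_sub (analyticAt_fst_comp hφ))
    exact (map_mono h𝓕).trans (hχ.tendsto_zero (by simp [hφ0]))
  have hmap : 𝓕₁.map ψ = 𝓕 := Ultrafilter.map_map_eq_of_eventually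
    (Eventually.of_forall fun z => by simp [hψdef])
  refine IsMonomializable.of_fibration (m := fun _ => 1) hψ hψ0 hmap
    (AnalyticAt.fun_comp (g := f) (by rwa [hψ0]) hψ) (fun j => IsMonomialGerm.coord j)
    (fun j => Eventually.of_forall fun z => rfl) (.of_ne_zero analyticAt_const one_ne_zero)
    (Eventually.of_forall fun z => (one_mul _).symm) ?_
  by_cases hne : ∃ i < k, ¬ ∀ᶠ x in 𝓝 0, a i x = 0
  · obtain ⟨ω, 𝓖, γ, e, hω, hω0, h𝓖, h𝓖map, hωj, hγ, he, he0, hae⟩ :=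
      exists_common_monomial (𝓕 := 𝓕₁.map Prod.fst)
        (hM _ ((map_mono h𝓕₁).trans (continuous_fst.tendsto' _ _ rfl))) ha ha0 hne
    obtain ⟨𝓗, h𝓗, h𝓗fst⟩ := Ultrafilter.exists_lift_prodMap h𝓖map
    have h𝓗0 : (𝓗 : Filter ((Fin n → ℝ) × ℝ)) ≤ 𝓝 0 := by
      have h1 : Tendsto Prod.fst (𝓗 : Filter ((Fin n → ℝ) × ℝ)) (𝓝 0) := by
        rw [Tendsto, ← Ultrafilter.coe_map, h𝓗fst]; exact h𝓖
      have h2 : Tendsto Prod.snd (𝓗 : Filter ((Fin n → ℝ) × ℝ)) (𝓝 0) := by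
        have h3 : Tendsto Prod.snd (𝓕₁ : Filter ((Fin n → ℝ) × ℝ)) (𝓝 0) :=
          (map_mono h𝓕₁).trans (continuous_snd.tendsto' _ _ rfl)
        rw [← h𝓗] at h3
        exact h3
      exact h1.prodMk_nhds h2
    set Ω : (Fin n → ℝ) × ℝ → (Fin n → ℝ) × ℝ := fun z => (ω z.1, z.2) with hΩdef
    have hΩ : AnalyticAt ℝ Ω 0 :=
      (AnalyticAt.fun_comp (g := ω) (f := Prod.fst) hω analyticAt_fst).prod analyticAt_snd
    have hΩ0 : Ω 0 = 0 := by simp [hΩdef, hω0]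
    refine IsMonomializable.of_fibration (m := fun _ => 1) hΩ hΩ0 h𝓗
      (g := fun z => f (ψ (Ω z)))
      (AnalyticAt.fun_comp (g := fun z => f (ψ z))
        (by rw [hΩ0]; exact AnalyticAt.fun_comp (g := f) (by rwa [hψ0]) hψ) hΩ) hωj
      (fun j => Eventually.of_forall fun z => rfl) (.of_ne_zero analyticAt_const one_ne_zero)
      (Eventually.of_forall fun z => (one_mul _).symm) ?_
    refine isMonomializable_of_common_monomial (u := fun z => u (Ω z)) h𝓗0 ih he he0 hγ
      (AnalyticAt.fun_comp (g := u) (by rwa [hΩ0]) hΩ) (by rwa [hΩ0]) ?_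
    have hae' : ∀ᶠ z : (Fin n → ℝ) × ℝ in 𝓝 0, ∀ i ∈ Finset.range k,
        a i (ω z.1) = e i z.1 * (∏ j, z.1 j ^ γ j) ^ (k + 1 - i) :=
      (Finset.eventually_all _).2 fun i hi =>
        (continuous_fst.tendsto' (0 : (Fin n → ℝ) × ℝ) 0 rfl).eventually
          (hae i (Finset.mem_range.1 hi))
    filter_upwards [hae', (hΩ.tendsto_zero hΩ0).eventually hfe] with z hz hz'
    rw [hψdef]
    refine hz'.trans (congrArg (· + z.2 ^ (k + 1) * u (Ω z)) ?_)
    exact Finset.sum_congr rfl fun i hi => by rw [← hz i hi]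
  · push Not at hne
    refine isMonomializable_of_splitChart h𝓕₁ ((((IsMonomialGerm.splitChart_snd.pow
      (k + 1)).mul (hcomp hu hu0)).mul hprod).congr ?_)
    have hne' : ∀ᶠ z : (Fin n → ℝ) × ℝ in 𝓝 0, ∀ i ∈ Finset.range k, a i z.1 = 0 :=
      (Finset.eventually_all _).2 fun i hi =>
        (continuous_fst.tendsto' (0 : (Fin n → ℝ) × ℝ) 0 rfl).eventually
          (hne i (Finset.mem_range.1 hi))
    filter_upwards [(hsplit.tendsto_zero (map_zero _)).eventually (hfe.and hne')] with x hx
    rw [hψdef, hx.1, Finset.sum_eq_zero, zero_add]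
    intro i hi
    rw [hx.2 i hi, zero_mul]

theorem exists_line_not_eventually_zero {V : Type*} [NormedAddCommGroup V] [NormedSpace ℝ V]
    {f : V → ℝ} (hf : AnalyticAt ℝ f 0) (h : ¬ ∀ᶠ x in 𝓝 0, f x = 0) :
    ∃ v, ¬ ∀ᶠ t : ℝ in 𝓝 0, f (t • v) = 0 := by
  obtain ⟨r, hr, hball⟩ := hf.exists_ball_analyticOnNhd
  obtain ⟨v, hv, hvr⟩ := ((not_eventually.1 h).and_eventually (Metric.ball_mem_nhds 0 hr)).exists
  refine ⟨v, fun hev => hv ?_⟩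
  have hmem : ∀ t ∈ Set.Icc (0 : ℝ) 1, t • v ∈ Metric.ball (0 : V) r := by
    intro t ht
    rw [dist_zero_right] at hvr
    rw [mem_ball_zero_iff]
    rw [norm_smul, Real.norm_of_nonneg ht.1]
    exact (mul_le_of_le_one_left (norm_nonneg v) ht.2).trans_lt hvr
  have hline : AnalyticOnNhd ℝ (fun t : ℝ => f (t • v)) (Set.Icc 0 1) := fun t ht =>
    AnalyticAt.fun_comp (g := f) (hball _ (hmem t ht)) (analyticAt_id.fun_smul analyticAt_const)
  simpa using hline.eqOn_zero_of_preconnected_of_eventuallyEq_zero isPreconnected_Icc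
    (Set.left_mem_Icc.2 zero_le_one) hev (Set.right_mem_Icc.2 zero_le_one)

theorem exists_prod_continuousLinearEquiv {v : Fin (n + 1) → ℝ} (hv : v ≠ 0) :
    ∃ L : ((Fin n → ℝ) × ℝ) ≃L[ℝ] (Fin (n + 1) → ℝ), L (0, 1) = v := by
  have hcard : Module.finrank ℝ ((Fin n → ℝ) × ℝ) = Module.finrank ℝ (Fin (n + 1) → ℝ) := by
    simp
  let L₀ : ((Fin n → ℝ) × ℝ) ≃L[ℝ] (Fin (n + 1) → ℝ) :=
    ContinuousLinearEquiv.ofFinrankEq hcard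
  have h0 : L₀ (0, 1) ≠ 0 := by simp
  obtain ⟨A, hA⟩ := SeparatingDual.exists_continuousLinearEquiv_apply_eq (R := ℝ) h0 hv
  exact ⟨L₀.trans A, hA⟩

/-- Local monomialization of real analytic functions along ultrafilters. -/
theorem isMonomializable_of_analyticAt (n : ℕ) :
    ∀ 𝓕 : Ultrafilter (Fin n → ℝ), (𝓕 : Filter (Fin n → ℝ)) ≤ 𝓝 0 →
      ∀ f : (Fin n → ℝ) → ℝ, AnalyticAt ℝ f 0 → (¬ ∀ᶠ x in 𝓝 0, f x = 0) →
      IsMonomializable n 𝓕 f := by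
  induction n with
  | zero =>
    intro 𝓕 h𝓕 f hf hne
    refine ⟨id, 𝓕, analyticAt_id, rfl, h𝓕, Ultrafilter.map_id _, .of_ne_zero hf fun h0 => hne ?_⟩
    exact Eventually.of_forall fun x => by rwa [Subsingleton.elim x 0]
  | succ n ih =>
    intro 𝓕 h𝓕 f hf hne
    by_cases hf0 : f 0 = 0
    swap
    · exact ⟨id, 𝓕, analyticAt_id, rfl, h𝓕, Ultrafilter.map_id _, .of_ne_zero hf hf0⟩
    obtain ⟨v, hv⟩ := exists_line_not_eventually_zero hf hne
    have hv0 : v ≠ 0 := by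
      rintro rfl
      exact hv (Eventually.of_forall fun t => by simpa using hf0)
    obtain ⟨L, hL⟩ := exists_prod_continuousLinearEquiv hv0
    have hLan : AnalyticAt ℝ L 0 := L.toContinuousLinearMap.analyticAt 0
    have hfL : AnalyticAt ℝ (fun z => f (L z)) 0 :=
      AnalyticAt.fun_comp (by rwa [map_zero]) hLan
    have hord : analyticOrderAt (fun t : ℝ => f (L (0, t))) 0 ≠ ⊤ := by
      rw [Ne, analyticOrderAt_eq_top]
      refine fun h => hv (h.mono fun t ht => ?_)
      rwa [← hL, ← map_smul, Prod.smul_mk, smul_zero, smul_eq_mul, mul_one]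
    obtain ⟨d, hd⟩ := ENat.ne_top_iff_exists.1 hord
    have h𝓕' : ((𝓕.map L.symm : Ultrafilter _) : Filter ((Fin n → ℝ) × ℝ)) ≤ 𝓝 0 :=
      (map_mono h𝓕).trans (L.symm.continuous.tendsto' _ _ (map_zero _))
    have hmap : (𝓕.map L.symm).map L = 𝓕 := Ultrafilter.map_map_eq_of_eventually
      (Eventually.of_forall fun x => L.apply_symm_apply x)
    obtain ⟨π, 𝓖, hπ, hπ0, h𝓖, hπmap, hmon⟩ :=
      isMonomializable_mul_prod_of_order ih d _ hfL hd.symm _ h𝓕'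
    refine .of_comp hLan (map_zero L) hmap ⟨π, 𝓖, hπ, hπ0, h𝓖, hπmap, ?_⟩
    refine IsMonomialGerm.of_mul_left
      (AnalyticAt.fun_comp (g := fun z => f (L z)) (by rwa [hπ0]) hπ) ?_ hmon
    exact Finset.analyticAt_fun_prod _ fun j _ => AnalyticAt.fun_comp
      (g := fun z : (Fin n → ℝ) × ℝ => z.1 j) (analyticAt_fst_coord j _) hπ

end Monomialization

theorem fderiv_monomial_self {n : ℕ} (α : Fin n → ℕ) (x : Fin n → ℝ) :
    fderiv ℝ (fun x : Fin n → ℝ => ∏ i, x i ^ α i) x x = (∑ i, α i : ℕ) * ∏ i, x i ^ α i := by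
  have hd : DifferentiableAt ℝ (fun x : Fin n → ℝ => ∏ i, x i ^ α i) ((1 : ℝ) • x) :=
    (analyticAt_monomial α _).differentiableAt
  have h1 := hd.hasFDerivAt.comp_hasDerivAt (1 : ℝ) ((hasDerivAt_id (1 : ℝ)).smul_const x)
  have h2 : HasDerivAt (fun t : ℝ => t ^ (∑ i, α i) * ∏ i, x i ^ α i)
      ((∑ i, α i : ℕ) * (1 : ℝ) ^ (∑ i, α i - 1) * ∏ i, x i ^ α i) 1 :=
    (hasDerivAt_pow (∑ i, α i) (1 : ℝ)).mul_const _
  have h3 := h1.unique (h2.congr_of_eventuallyEq (Eventually.of_forall fun t => by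
    simp [mul_pow, Finset.prod_mul_distrib, Finset.prod_pow_eq_pow_sum]))
  simpa using h3

/-- Euler-type estimates for the radial derivative of a monomial germ. -/
theorem IsMonomialGerm.exists_fderiv_self_le {n : ℕ} {g : (Fin n → ℝ) → ℝ}
    (hg : IsMonomialGerm g) : ∃ C : ℝ, ∀ᶠ x in 𝓝 0, |fderiv ℝ g x x| ≤ C * |g x| ∧
      (g 0 = 0 → g x ^ 2 ≤ 2 * (g x * fderiv ℝ g x x)) := by
  obtain ⟨α, h, hh, hh0, hgh⟩ := hg
  set N := ∑ i, α i with hN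
  have hcont : Tendsto (fun x => fderiv ℝ h x x) (𝓝 0) (𝓝 0) := by
    have h1 : ContinuousAt (fun x => fderiv ℝ h x x) 0 :=
      hh.fderiv.continuousAt.clm_apply continuousAt_id
    simpa [ContinuousAt] using h1
  have hsmall : ∀ᶠ x in 𝓝 0, |fderiv ℝ h x x| ≤ 1 / 2 * |h x| := by
    have h1 : Tendsto (fun x => 1 / 2 * |h x|) (𝓝 0) (𝓝 (1 / 2 * |h 0|)) :=
      hh.continuousAt.tendsto.abs.const_mul _
    have h2 := (hcont.abs.eventually_lt h1 (by simpa using hh0))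
    exact h2.mono fun x hx => hx.le
  refine ⟨N + 1 / 2, ?_⟩
  filter_upwards [hgh.eventually_nhds, hh.eventually_analyticAt, hsmall] with x hx hhx hs
  set M := ∏ i, x i ^ α i
  have hgx : g x = M * h x := hx.self_of_nhds
  have hder : fderiv ℝ g x x = N * (M * h x) + M * fderiv ℝ h x x := by
    rw [Filter.EventuallyEq.fderiv_eq hx,
      fderiv_fun_mul (analyticAt_monomial α x).differentiableAt hhx.differentiableAt]
    simp only [add_apply, smul_apply, smul_eq_mul,
      fderiv_monomial_self]
    ring
  have hN0 : (0 : ℝ) ≤ N := Nat.cast_nonneg N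
  rw [hder, hgx]
  constructor
  · calc |N * (M * h x) + M * fderiv ℝ h x x|
        ≤ |N * (M * h x)| + |M * fderiv ℝ h x x| := abs_add_le _ _
      _ = N * |M * h x| + |M| * |fderiv ℝ h x x| := by
        rw [abs_mul, abs_mul M (fderiv ℝ h x x), abs_of_nonneg hN0]
      _ ≤ N * |M * h x| + |M| * (1 / 2 * |h x|) := by gcongr
      _ = (N + 1 / 2) * |M * h x| := by rw [abs_mul]; ring
  · intro hg0
    have hN1 : (1 : ℝ) ≤ N := by
      rw [Nat.one_le_cast, Nat.one_le_iff_ne_zero]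
      intro hN'
      have hα : ∀ i, α i = 0 := by simpa [hN] using hN'
      rw [hgh.self_of_nhds] at hg0
      simp [hα, hh0] at hg0
    have h1 : -(1 / 2 * h x ^ 2) ≤ h x * fderiv ℝ h x x := by
      have h2 := neg_abs_le (h x * fderiv ℝ h x x)
      rw [abs_mul] at h2
      nlinarith [mul_le_mul_of_nonneg_left hs (abs_nonneg (h x)), sq_abs (h x)]
    nlinarith [mul_nonneg (sub_nonneg.2 hN1) (sq_nonneg (M * h x)),
      mul_le_mul_of_nonneg_left h1 (sq_nonneg M)]

/-- `HasRadialVector f C x` means that there is a vector comparable to `x` in norm and in the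
direction of `x`, along which the components of `f` vary at most proportionally to their size. -/
def HasRadialVector {n p : ℕ} (f : EuclideanSpace ℝ (Fin n) → EuclideanSpace ℝ (Fin p))
    (C : ℝ) (x : EuclideanSpace ℝ (Fin n)) : Prop :=
  ∃ ξ : EuclideanSpace ℝ (Fin n), ‖ξ‖ ≤ C * ‖x‖ ∧ ‖x‖ ^ 2 ≤ C * inner ℝ x ξ ∧
    ∀ j, |fderiv ℝ f x ξ j| ≤ C * |f x j|

theorem HasRadialVector.mono {n p : ℕ}
    {f : EuclideanSpace ℝ (Fin n) → EuclideanSpace ℝ (Fin p)} {C C' : ℝ}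
    {x : EuclideanSpace ℝ (Fin n)} (h : HasRadialVector f C x) (hC : 0 < C) (hCC' : C ≤ C') :
    HasRadialVector f C' x := by
  obtain ⟨ξ, h1, h2, h3⟩ := h
  have h4 : 0 ≤ inner ℝ x ξ := by
    by_contra! hlt
    nlinarith [sq_nonneg ‖x‖, mul_pos_of_neg_of_neg hlt (neg_neg_of_pos hC)]
  exact ⟨ξ, h1.trans (by gcongr), h2.trans (by gcongr), fun j => (h3 j).trans (by gcongr)⟩

theorem fderiv_euclidean_apply {E : Type*} [NormedAddCommGroup E] [NormedSpace ℝ E] {p : ℕ}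
    {f : E → EuclideanSpace ℝ (Fin p)} {x : E} (hf : DifferentiableAt ℝ f x) (v : E) (j : Fin p) :
    fderiv ℝ (fun y => f y j) x v = fderiv ℝ f x v j := by
  have h := ((EuclideanSpace.proj (𝕜 := ℝ) (ι := Fin p) j).hasFDerivAt
    (x := f x)).comp x hf.hasFDerivAt
  have h' : HasFDerivAt (fun y => f y j) _ x := h
  rw [h'.fderiv]
  rfl

theorem exists_eventually_hasRadialVector_ultrafilter {n p : ℕ}
    {f : EuclideanSpace ℝ (Fin n) → EuclideanSpace ℝ (Fin p)} (hf : AnalyticAt ℝ f 0)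
    {𝓕 : Ultrafilter (EuclideanSpace ℝ (Fin n))}
    (h𝓕 : (𝓕 : Filter (EuclideanSpace ℝ (Fin n))) ≤ 𝓝 0) :
    ∃ C > 0, ∀ᶠ x in 𝓕, HasRadialVector f C x := by
  classical
  set E := EuclideanSpace.equiv (Fin n) ℝ
  have hcomp : ∀ j, AnalyticAt ℝ (fun x => f x j) 0 := fun j =>
    AnalyticAt.fun_comp (g := EuclideanSpace.proj (𝕜 := ℝ) (ι := Fin p) j)
      (ContinuousLinearMap.analyticAt _ _) hf
  have hEs : AnalyticAt ℝ E.symm 0 := E.symm.toContinuousLinearMap.analyticAt 0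
  set s := Finset.univ.filter fun j : Fin p => ¬ ∀ᶠ x in 𝓝 0, f x j = 0 with hs
  obtain ⟨π, 𝓖, hπ, hπ0, h𝓖, hmap, hFm, hπm⟩ := exists_simultaneous_monomialization
    (s := s) (F := fun j x => f (E.symm x) j) (𝓕 := 𝓕.map E)
    (isMonomializable_of_analyticAt n _
      ((map_mono h𝓕).trans (E.continuous.tendsto' _ _ (map_zero _))))
    (fun j _ => AnalyticAt.fun_comp (g := fun x => f x j) (by rw [map_zero]; exact hcomp j) hEs)
    (fun j hj hev => (Finset.mem_filter.1 hj).2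
      (((E.continuous.tendsto' _ _ (map_zero _)).eventually hev).mono fun x hx => by
        simpa using hx))
  set Φ : (Fin n → ℝ) → EuclideanSpace ℝ (Fin n) := fun u => E.symm (π u) with hΦdef
  have hΦ : AnalyticAt ℝ Φ 0 := AnalyticAt.fun_comp (by rwa [hπ0]) hπ
  have hΦ0 : Φ 0 = 0 := by simp [hΦdef, hπ0]
  have hΦmap : 𝓖.map Φ = 𝓕 := by
    have h1 : (𝓖.map π).map E.symm = 𝓕 := by
      rw [hmap]
      exact Ultrafilter.map_map_eq_of_eventually
        (Eventually.of_forall fun x => E.symm_apply_apply x)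
    rwa [Ultrafilter.map_map] at h1
  choose A hA using fun j => (hπm j).exists_fderiv_self_le
  have hB : ∀ j, ∃ B : ℝ, ∀ᶠ u in 𝓝 0, |fderiv ℝ (fun u => f (Φ u) j) u u| ≤ B * |f (Φ u) j| := by
    intro j
    by_cases hj : j ∈ s
    · obtain ⟨B, hB⟩ := (hFm j hj).exists_fderiv_self_le
      exact ⟨B, hB.mono fun u hu => hu.1⟩
    · have hj' : ∀ᶠ x in 𝓝 0, f x j = 0 := by simpa [hs] using hj
      refine ⟨0, ((hΦ.tendsto_zero hΦ0).eventually hj').eventually_nhds.mono fun u hu => ?_⟩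
      have h0 : fderiv ℝ (fun u => f (Φ u) j) u = 0 := by
        rw [Filter.EventuallyEq.fderiv_eq (f := fun _ => (0 : ℝ)) hu]
        simp
      simp [h0]
  choose B hB using hB
  obtain ⟨A', hA'⟩ := Finite.exists_le A
  obtain ⟨B', hB'⟩ := Finite.exists_le B
  set C := max 2 (max A' B')
  have hC2 : 2 ≤ C := le_max_left _ _
  have hAC : ∀ j, A j ≤ C := fun j => (hA' j).trans ((le_max_left _ _).trans (le_max_right _ _))
  have hBC : ∀ j, B j ≤ C := fun j => (hB' j).trans ((le_max_right _ _).trans (le_max_right _ _))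
  refine ⟨C, by positivity, ?_⟩
  rw [← hΦmap, Ultrafilter.coe_map, eventually_map]
  refine Eventually.filter_mono h𝓖 ?_
  filter_upwards [eventually_all.2 hA, eventually_all.2 hB, hΦ.eventually_analyticAt,
    (hΦ.tendsto_zero hΦ0).eventually hf.eventually_analyticAt] with u hAu hBu hΦu hfu
  have hξ : ∀ j, fderiv ℝ (fun u => π u j) u u = fderiv ℝ Φ u u j := fun j =>
    fderiv_euclidean_apply hΦu.differentiableAt u j
  refine ⟨fderiv ℝ Φ u u, ?_, ?_, fun j => ?_⟩
  · rw [← abs_of_nonneg (norm_nonneg (fderiv ℝ Φ u u)),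
      ← abs_of_nonneg (mul_nonneg (by positivity : 0 ≤ C) (norm_nonneg (Φ u))), ← sq_le_sq,
      mul_pow, EuclideanSpace.norm_sq_eq, EuclideanSpace.norm_sq_eq, Finset.mul_sum]
    refine Finset.sum_le_sum fun j _ => ?_
    rw [← mul_pow]
    refine pow_le_pow_left₀ (norm_nonneg _) ?_ 2
    have h1 := (hAu j).1
    rw [hξ] at h1
    exact h1.trans (mul_le_mul_of_nonneg_right (hAC j) (abs_nonneg _))
  · have h1 : ‖Φ u‖ ^ 2 ≤ 2 * inner ℝ (Φ u) (fderiv ℝ Φ u u) := by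
      rw [EuclideanSpace.norm_sq_eq, PiLp.inner_apply, Finset.mul_sum]
      refine Finset.sum_le_sum fun j _ => ?_
      have h2 := (hAu j).2 (by rw [hπ0]; rfl)
      rw [hξ] at h2
      rw [Real.norm_eq_abs, sq_abs]
      refine h2.trans_eq ?_
      simp only [RCLike.inner_apply, conj_trivial]
      rw [mul_comm (π u j)]
      rfl
    have h2 : 0 ≤ inner ℝ (Φ u) (fderiv ℝ Φ u u) := by nlinarith [sq_nonneg ‖Φ u‖]
    exact h1.trans (by gcongr)
  · have h1 := hBu j
    have h2 : fderiv ℝ (fun u => f (Φ u)) u = (fderiv ℝ f (Φ u)).comp (fderiv ℝ Φ u) :=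
      fderiv_comp u hfu.differentiableAt hΦu.differentiableAt
    rw [fderiv_euclidean_apply (f := fun u => f (Φ u))
      (hfu.differentiableAt.comp u hΦu.differentiableAt), h2] at h1
    exact h1.trans (mul_le_mul_of_nonneg_right (hBC j) (abs_nonneg _))

theorem exists_eventually_hasRadialVector {n p : ℕ}
    {f : EuclideanSpace ℝ (Fin n) → EuclideanSpace ℝ (Fin p)} (hf : AnalyticAt ℝ f 0) :
    ∃ C > 0, ∀ᶠ x in 𝓝 0, HasRadialVector f C x := by
  by_contra! hcon
  have hseq : ∀ N : ℕ, ∃ x, ‖x‖ < 1 / ((N : ℝ) + 1) ∧ ¬ HasRadialVector f ((N : ℝ) + 1) x := by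
    intro N
    have h1 := hcon ((N : ℝ) + 1) (by positivity)
    obtain ⟨x, hx, hx'⟩ := (h1.and_eventually
      (Metric.ball_mem_nhds 0 (Nat.one_div_pos_of_nat (α := ℝ) (n := N)))).exists
    exact ⟨x, by simpa using hx', hx⟩
  choose x hx hx' using hseq
  have hx0 : Tendsto x atTop (𝓝 0) :=
    squeeze_zero_norm (fun N => (hx N).le) tendsto_one_div_add_atTop_nhds_zero_nat
  have hle : ((hyperfilter ℕ : Ultrafilter ℕ) : Filter ℕ) ≤ atTop := by
    rw [← Nat.cofinite_eq_atTop]; exact hyperfilter_le_cofinite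
  obtain ⟨C, hC, hev⟩ := exists_eventually_hasRadialVector_ultrafilter hf
    (𝓕 := (hyperfilter ℕ).map x) ((map_mono hle).trans hx0)
  rw [Ultrafilter.coe_map, eventually_map] at hev
  obtain ⟨N₀, hN₀⟩ := exists_nat_ge C
  obtain ⟨N, hN, hN'⟩ := (hev.and ((eventually_ge_atTop N₀).filter_mono hle)).exists
  refine hx' N (hN.mono hC ?_)
  have : (N₀ : ℝ) ≤ N := by exact_mod_cast hN'
  linarith

open scoped Classical in
/-- The absolute value of the maximal minor of `B` with columns `κ`, set to zero unless `κ` is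
strictly increasing. -/
noncomputable def absMinor {q n : ℕ} (B : Matrix (Fin q) (Fin n) ℝ) (κ : Fin q → Fin n) : ℝ :=
  if StrictMono κ then |(B.submatrix id κ).det| else 0

theorem absMinor_nonneg {q n : ℕ} (B : Matrix (Fin q) (Fin n) ℝ) (κ : Fin q → Fin n) :
    0 ≤ absMinor B κ := by
  unfold absMinor
  split_ifs
  exacts [abs_nonneg _, le_rfl]

theorem absMinor_of_strictMono {q n : ℕ} (B : Matrix (Fin q) (Fin n) ℝ) {κ : Fin q → Fin n}
    (h : StrictMono κ) : absMinor B κ = |(B.submatrix id κ).det| := if_pos h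

theorem absMinor_le_sum {q n : ℕ} (B : Matrix (Fin q) (Fin n) ℝ) (κ : Fin q → Fin n) :
    absMinor B κ ≤ ∑ κ', absMinor B κ' :=
  Finset.single_le_sum (fun κ' _ => absMinor_nonneg B κ') (Finset.mem_univ κ)

theorem abs_det_submatrix_le_sum_absMinor {q n : ℕ} (B : Matrix (Fin q) (Fin n) ℝ)
    (κ : Fin q → Fin n) : |(B.submatrix id κ).det| ≤ ∑ κ', absMinor B κ' := by
  by_cases hκ : Function.Injective κ
  · set σ := Tuple.sort κ
    have hσ : StrictMono (κ ∘ σ) :=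
      (Tuple.monotone_sort κ).strictMono_of_injective (hκ.comp σ.injective)
    have h1 : |(B.submatrix id (κ ∘ σ)).det| = |(B.submatrix id κ).det| := by
      have h2 := Matrix.det_permute' σ (B.submatrix id κ)
      rw [Matrix.submatrix_submatrix] at h2
      rw [← Function.comp_id (id : Fin q → Fin q), h2, abs_mul]
      rcases Int.units_eq_one_or (Equiv.Perm.sign σ) with h | h <;> simp [h]
    rw [← h1, ← absMinor_of_strictMono B hσ]
    exact absMinor_le_sum B _
  · obtain ⟨i, j, hij, hne⟩ := Function.not_injective_iff.1 hκ
    rw [Matrix.det_zero_of_column_eq hne fun k => by simp [hij], abs_zero]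
    exact Finset.sum_nonneg fun κ' _ => absMinor_nonneg B κ'

theorem abs_det_le_factorial_mul_prod {q : ℕ} {M : Matrix (Fin q) (Fin q) ℝ} {v : Fin q → ℝ}
    (h : ∀ i j, |M i j| ≤ v i) : |M.det| ≤ q.factorial * ∏ i, v i := by
  rw [Matrix.det_apply]
  refine (Finset.abs_sum_le_sum_abs _ _).trans ?_
  refine (Finset.sum_le_card_nsmul _ _ (∏ i, v i) fun σ _ => ?_).trans_eq ?_
  · have h1 : |Equiv.Perm.sign σ • ∏ i, M (σ i) i| = ∏ i, |M (σ i) i| := by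
      rw [← Finset.abs_prod]
      rcases Int.units_eq_one_or (Equiv.Perm.sign σ) with h | h <;> simp [h]
    rw [h1, ← Equiv.prod_comp σ v]
    exact Finset.prod_le_prod (fun i _ => abs_nonneg _) fun i _ => h _ _
  · rw [nsmul_eq_mul, Finset.card_univ, Fintype.card_perm, Fintype.card_fin]

/-- The matrix `A` with the additional last row `y`. -/
def appendRow {p n : ℕ} (A : Matrix (Fin p) (Fin n) ℝ) (y : Fin n → ℝ) :
    Matrix (Fin (p + 1)) (Fin n) ℝ := fun j k => if h : (j : ℕ) < p then A ⟨j, h⟩ k else y k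

theorem appendRow_castSucc {p n : ℕ} (A : Matrix (Fin p) (Fin n) ℝ) (y : Fin n → ℝ)
    (j : Fin p) : appendRow A y j.castSucc = A j := by
  ext k; simp [appendRow]

theorem appendRow_last {p n : ℕ} (A : Matrix (Fin p) (Fin n) ℝ) (y : Fin n → ℝ) :
    appendRow A y (Fin.last p) = y := by
  ext k; simp [appendRow]

theorem absMinor_appendRow_le {p n : ℕ} (A : Matrix (Fin p) (Fin n) ℝ) {y : Fin n → ℝ} {r : ℝ}
    (hy : ∀ k, |y k| ≤ r) (κ : Fin (p + 1) → Fin n) :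
    absMinor (appendRow A y) κ ≤ (p + 1) * (r * ∑ ι, absMinor A ι) := by
  by_cases hκ : StrictMono κ
  · rw [absMinor_of_strictMono _ hκ, Matrix.det_succ_row _ (Fin.last p)]
    refine (Finset.abs_sum_le_sum_abs _ _).trans ?_
    refine (Finset.sum_le_card_nsmul _ _ (r * ∑ ι, absMinor A ι) fun k _ => ?_).trans_eq ?_
    · rw [abs_mul, abs_mul, abs_pow, abs_neg, abs_one, one_pow, one_mul, Matrix.submatrix_apply,
        id, appendRow_last]
      refine mul_le_mul (hy _) ?_ (abs_nonneg _) ((abs_nonneg _).trans (hy (κ k)))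
      have h1 : ((appendRow A y).submatrix id κ).submatrix (Fin.last p).succAbove k.succAbove =
          A.submatrix id (κ ∘ k.succAbove) := by
        ext i j
        simp [appendRow_castSucc]
      rw [h1]
      exact abs_det_submatrix_le_sum_absMinor A _
    · simp
  · rw [absMinor, if_neg hκ]
    rcases isEmpty_or_nonempty (Fin n) with hn | ⟨⟨k⟩⟩
    · exact (hn.false (κ 0)).elim
    · have hr : 0 ≤ r := (abs_nonneg _).trans (hy k)
      have hs : 0 ≤ ∑ ι, absMinor A ι := Finset.sum_nonneg fun ι _ => absMinor_nonneg A ι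
      positivity

theorem sum_mul_det_submatrix_snoc {p n : ℕ} (B : Matrix (Fin (p + 1)) (Fin n) ℝ)
    (ι : Fin p → Fin n) (ξ : Fin n → ℝ) :
    ∑ i, ξ i * (B.submatrix id (Fin.snoc ι i : Fin (p + 1) → Fin n)).det =
      ∑ j : Fin (p + 1), (-1) ^ ((j : ℕ) + p) * (B.mulVec ξ) j *
        (B.submatrix j.succAbove ι).det := by
  have h : ∀ i, (B.submatrix id (Fin.snoc ι i : Fin (p + 1) → Fin n)).det =
      ∑ j : Fin (p + 1), (-1) ^ ((j : ℕ) + p) * B j i * (B.submatrix j.succAbove ι).det := by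
    intro i
    rw [Matrix.det_succ_column _ (Fin.last p)]
    refine Finset.sum_congr rfl fun j _ => ?_
    have h1 : (B.submatrix id (Fin.snoc ι i : Fin (p + 1) → Fin n)).submatrix j.succAbove
        (Fin.last p).succAbove = B.submatrix j.succAbove ι := by
      ext a b
      simp
    rw [h1]
    simp
  simp only [h, Finset.mul_sum, Matrix.mulVec, dotProduct, Finset.sum_mul]
  rw [Finset.sum_comm]
  refine Finset.sum_congr rfl fun j _ => Finset.sum_congr rfl fun i _ => ?_
  ring

theorem abs_dotProduct_mul_abs_det_le {p n : ℕ} {A : Matrix (Fin p) (Fin n) ℝ}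
    {y ξ : Fin n → ℝ} {S r t s : ℝ} (hS : 1 ≤ S) (hA : ∀ j k, |A j k| ≤ S)
    (hy : ∀ k, |y k| ≤ r) (hr : 0 ≤ r) (hξ : ∀ k, |ξ k| ≤ s)
    (hAξ : ∀ j, |(A.mulVec ξ) j| ≤ t) (ι : Fin p → Fin n) :
    |y ⬝ᵥ ξ| * |(A.submatrix id ι).det| ≤
      n * (s * ∑ κ, absMinor (appendRow A y) κ) + p * (t * (p.factorial * (S ^ p * r))) := by
  set B := appendRow A y with hB
  have hexp := sum_mul_det_submatrix_snoc B ι ξ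
  rw [Fin.sum_univ_castSucc] at hexp
  have hlast : (-1 : ℝ) ^ (((Fin.last p : Fin (p + 1)) : ℕ) + p) * (B.mulVec ξ) (Fin.last p) *
      (B.submatrix (Fin.last p).succAbove ι).det = (y ⬝ᵥ ξ) * (A.submatrix id ι).det := by
    have h1 : B.submatrix (Fin.last p).succAbove ι = A.submatrix id ι := by
      ext a b
      simp [hB, appendRow_castSucc]
    rw [h1, Fin.val_last, ← two_mul, pow_mul, neg_one_sq, one_pow, one_mul, Matrix.mulVec, hB,
      appendRow_last]
  rw [hlast] at hexp
  rw [← abs_mul, ← sub_eq_iff_eq_add'.2 hexp]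
  refine (abs_sub _ _).trans (add_le_add ?_ ?_)
  · refine (Finset.abs_sum_le_sum_abs _ _).trans
      ((Finset.sum_le_card_nsmul _ _ (s * ∑ κ, absMinor B κ) fun i _ => ?_).trans_eq (by simp))
    rw [abs_mul]
    exact mul_le_mul (hξ i) (abs_det_submatrix_le_sum_absMinor B _) (abs_nonneg _)
      ((abs_nonneg _).trans (hξ i))
  · refine (Finset.abs_sum_le_sum_abs _ _).trans ((Finset.sum_le_card_nsmul _ _
      (t * (p.factorial * (S ^ p * r))) fun j _ => ?_).trans_eq (by simp))
    rw [abs_mul, abs_mul, abs_pow, abs_neg, abs_one, one_pow, one_mul, Matrix.mulVec, hB,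
      appendRow_castSucc]
    refine mul_le_mul (hAξ j) ?_ (abs_nonneg _) ((abs_nonneg _).trans (hAξ j))
    set v : Fin (p + 1) → ℝ := Fin.snoc (fun _ => S) r with hv
    have hbound : ∀ a k, |appendRow A y a k| ≤ v a := by
      intro a k
      refine Fin.lastCases ?_ (fun a => ?_) a
      · simpa [hv, appendRow_last] using hy k
      · simpa [hv, appendRow_castSucc] using hA a k
    have hv0 : ∀ a, 0 ≤ v a := by
      intro a
      refine Fin.lastCases ?_ (fun a => ?_) a
      · simpa [hv] using hr
      · simpa [hv] using zero_le_one.trans hS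
    refine (abs_det_le_factorial_mul_prod (v := fun a => v (j.castSucc.succAbove a))
      fun a b => hbound _ _).trans ?_
    gcongr
    calc ∏ a, v (j.castSucc.succAbove a)
        ≤ v j.castSucc * ∏ a, v (j.castSucc.succAbove a) :=
          le_mul_of_one_le_left (Finset.prod_nonneg fun a _ => hv0 _) (by simpa [hv] using hS)
      _ = S ^ p * r := by
          rw [← Fin.prod_univ_succAbove, Fin.prod_univ_castSucc]
          simp [hv]

theorem exists_sum_pow_le_of_le {α β : Type*} [Fintype α] [Fintype β] {K : ℝ} (hK : 0 ≤ K)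
    (m : ℕ) : ∃ K' > 0, ∀ (a : α → ℝ) (b : β → ℝ) (t : ℝ), (∀ i, 0 ≤ a i) → (∀ i, 0 ≤ b i) →
      0 ≤ t → (∀ i, a i ≤ K * (∑ j, b j + t)) →
      ∑ i, a i ^ (m + 1) + t ^ (m + 1) ≤ K' * (∑ j, b j ^ (m + 1) + t ^ (m + 1)) := by
  set L : ℝ := (Fintype.card (Option β) : ℝ) ^ m with hL
  have hL0 : 0 < L := by positivity
  refine ⟨Fintype.card α * (K ^ (m + 1) * L) + 1, by positivity, fun a b t ha hb ht h => ?_⟩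
  have hpow : (∑ j, b j + t) ^ (m + 1) ≤ L * (∑ j, b j ^ (m + 1) + t ^ (m + 1)) := by
    have h1 := pow_sum_div_card_le_sum_pow (s := (Finset.univ : Finset (Option β)))
      (f := fun o => o.elim t b) (fun o _ => by cases o <;> simp [ht, hb]) m
    rw [Finset.card_univ, ← hL, div_le_iff₀ hL0, mul_comm _ L] at h1
    simpa [add_comm t, add_comm (t ^ (m + 1))] using h1
  have hsum : 0 ≤ ∑ j, b j ^ (m + 1) := Finset.sum_nonneg fun j _ => pow_nonneg (hb j) _
  have h1 : ∑ i, a i ^ (m + 1) ≤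
      Fintype.card α * (K ^ (m + 1) * (L * (∑ j, b j ^ (m + 1) + t ^ (m + 1)))) := by
    refine (Finset.sum_le_card_nsmul _ _ (K ^ (m + 1) *
      (L * (∑ j, b j ^ (m + 1) + t ^ (m + 1)))) fun i _ => ?_).trans_eq (by simp)
    refine (pow_le_pow_left₀ (ha i) (h i) _).trans ?_
    rw [mul_pow]
    exact mul_le_mul_of_nonneg_left hpow (pow_nonneg hK _)
  linarith

/-- The Jacobian matrix of `f` at `x`. -/
noncomputable def jacobian {n p : ℕ} (f : EuclideanSpace ℝ (Fin n) → EuclideanSpace ℝ (Fin p))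
    (x : EuclideanSpace ℝ (Fin n)) : Matrix (Fin p) (Fin n) ℝ :=
  fun j k => fderiv ℝ f x (EuclideanSpace.single k 1) j

theorem jacobian_mulVec {n p : ℕ} (f : EuclideanSpace ℝ (Fin n) → EuclideanSpace ℝ (Fin p))
    (x ξ : EuclideanSpace ℝ (Fin n)) : (jacobian f x).mulVec ξ = fderiv ℝ f x ξ := by
  ext j
  have h : ξ = ∑ k, ξ k • EuclideanSpace.single k (1 : ℝ) := by
    ext i
    simp [Finset.sum_apply, Pi.single_apply]
  conv_rhs => rw [h]
  simp [Matrix.mulVec, dotProduct, jacobian, mul_comm]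

theorem kuoQ_eq {n p : ℕ} (m : ℕ)
    (f : EuclideanSpace ℝ (Fin n) → EuclideanSpace ℝ (Fin p)) (x : EuclideanSpace ℝ (Fin n)) :
    KuoQ n p (m + 1) f x =
      ∑ ι, (‖x‖ * absMinor (jacobian f x) ι) ^ (m + 1) + ‖f x‖ ^ (m + 1) := by
  rw [KuoQ, Finset.mul_sum]
  congr 1
  refine Finset.sum_congr rfl fun ι _ => ?_
  rw [mul_pow, absMinor]
  split_ifs
  · rfl
  · simp

theorem thomQ_eq {n p : ℕ} (m : ℕ)
    (f : EuclideanSpace ℝ (Fin n) → EuclideanSpace ℝ (Fin p)) (x : EuclideanSpace ℝ (Fin n)) :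
    ThomQ n p (m + 1) f x =
      ∑ κ, absMinor (appendRow (jacobian f x) fun k => 2 * x k) κ ^ (m + 1) + ‖f x‖ ^ (m + 1) := by
  rw [ThomQ]
  congr 1
  refine Finset.sum_congr rfl fun κ _ => ?_
  rw [absMinor]
  split_ifs
  · rfl
  · simp

theorem abs_two_mul_apply_le {n : ℕ} (x : EuclideanSpace ℝ (Fin n)) (k : Fin n) :
    |2 * x k| ≤ 2 * ‖x‖ := by
  rw [abs_mul, abs_two]
  gcongr
  exact PiLp.norm_apply_le x k

theorem exists_norm_mul_absMinor_le {n p : ℕ}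
    {f : EuclideanSpace ℝ (Fin n) → EuclideanSpace ℝ (Fin p)} (hf : AnalyticAt ℝ f 0) :
    ∃ K ≥ 0, ∀ᶠ x in 𝓝 0, ∀ ι, ‖x‖ * absMinor (jacobian f x) ι ≤
      K * (∑ κ, absMinor (appendRow (jacobian f x) fun k => 2 * x k) κ + ‖f x‖) := by
  obtain ⟨C, hC, hrad⟩ := exists_eventually_hasRadialVector hf
  obtain ⟨S, hS1, hS⟩ : ∃ S ≥ 1, ∀ᶠ x in 𝓝 0, ∀ j k, |jacobian f x j k| ≤ S := by
    refine ⟨‖fderiv ℝ f 0‖ + 1, by simp, ?_⟩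
    have h1 : ∀ᶠ x in 𝓝 0, ‖fderiv ℝ f x‖ < ‖fderiv ℝ f 0‖ + 1 :=
      hf.fderiv.continuousAt.norm.eventually_lt continuousAt_const (lt_add_one _)
    filter_upwards [h1] with x hx j k
    calc |jacobian f x j k| ≤ ‖fderiv ℝ f x (EuclideanSpace.single k 1)‖ :=
          PiLp.norm_apply_le (fderiv ℝ f x (EuclideanSpace.single k 1)) j
      _ ≤ ‖fderiv ℝ f x‖ * ‖EuclideanSpace.single k (1 : ℝ)‖ := ContinuousLinearMap.le_opNorm _ _
      _ ≤ ‖fderiv ℝ f 0‖ + 1 := by simpa using hx.le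
  set Q : ℝ := p * (C * (p.factorial * S ^ p)) * 2 with hQ
  have hQ0 : 0 ≤ Q := by positivity
  refine ⟨C / 2 * (n * C + Q), by positivity, ?_⟩
  filter_upwards [hrad, hS] with x hx hSx ι
  set T := ∑ κ, absMinor (appendRow (jacobian f x) fun k => 2 * x k) κ with hT
  have hT0 : 0 ≤ T := Finset.sum_nonneg fun κ _ => absMinor_nonneg _ κ
  rcases (norm_nonneg x).eq_or_lt with hx0 | hx0
  · rw [← hx0, zero_mul]
    positivity
  obtain ⟨ξ, hξ, hxξ, hfξ⟩ := hx
  by_cases hι : StrictMono ι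
  swap
  · rw [absMinor, if_neg hι, mul_zero]
    positivity
  rw [absMinor_of_strictMono _ hι]
  have hmain := abs_dotProduct_mul_abs_det_le (A := jacobian f x) (y := fun k => 2 * x k)
    (ξ := ξ) (r := 2 * ‖x‖) (s := C * ‖x‖) (t := C * ‖f x‖) hS1 hSx (abs_two_mul_apply_le x)
    (by positivity) (fun k => (PiLp.norm_apply_le ξ k).trans hξ)
    (fun j => by
      rw [jacobian_mulVec]
      exact (hfξ j).trans (mul_le_mul_of_nonneg_left (PiLp.norm_apply_le (f x) j) hC.le)) ι
  rw [← hT] at hmain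
  set D := |((jacobian f x).submatrix id ι).det|
  have hdot : 2 * inner ℝ x ξ ≤ |(fun k => 2 * x k) ⬝ᵥ (ξ : Fin n → ℝ)| := by
    refine le_trans (le_of_eq ?_) (le_abs_self _)
    simp only [PiLp.inner_apply, RCLike.inner_apply, conj_trivial, dotProduct, Finset.mul_sum]
    exact Finset.sum_congr rfl fun k _ => by ring
  have hD : 0 ≤ D := abs_nonneg _
  have h1 : ‖x‖ * (‖x‖ * D) ≤ ‖x‖ * (C / 2 * (n * C * T + Q * ‖f x‖)) := by
    calc ‖x‖ * (‖x‖ * D) = ‖x‖ ^ 2 * D := by ring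
      _ ≤ C * inner ℝ x ξ * D := by gcongr
      _ = C / 2 * (2 * inner ℝ x ξ * D) := by ring
      _ ≤ C / 2 * (|(fun k => 2 * x k) ⬝ᵥ (ξ : Fin n → ℝ)| * D) := by gcongr
      _ ≤ C / 2 * (n * (C * ‖x‖ * T) +
          p * (C * ‖f x‖ * (p.factorial * (S ^ p * (2 * ‖x‖))))) := by gcongr
      _ = ‖x‖ * (C / 2 * (n * C * T + Q * ‖f x‖)) := by rw [hQ]; ring
  refine (le_of_mul_le_mul_left h1 hx0).trans ?_
  rw [mul_assoc (C / 2)]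
  refine mul_le_mul_of_nonneg_left ?_ (half_pos hC).le
  have h2 : 0 ≤ (n : ℝ) * C * ‖f x‖ := by positivity
  nlinarith [mul_nonneg hQ0 hT0]

theorem kuo_equiv_thom_analytic (n p : ℕ) (hp : 1 ≤ p) (hpn : p ≤ n)
    (f : EuclideanSpace ℝ (Fin n) → EuclideanSpace ℝ (Fin p))
    (U : Set (EuclideanSpace ℝ (Fin n))) (hU : U ∈ nhds 0)
    (hf : AnalyticOnNhd ℝ f U) (hf0 : f 0 = 0) (m : ℕ) (hm : 0 < m) :
    (∃ K > (0 : ℝ), ∃ δ > (0 : ℝ), ∀ x : EuclideanSpace ℝ (Fin n),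
        ‖x‖ ≤ δ → KuoQ n p m f x ≤ K * ThomQ n p m f x) ∧
    (∃ K > (0 : ℝ), ∃ δ > (0 : ℝ), ∀ x : EuclideanSpace ℝ (Fin n),
        ‖x‖ ≤ δ → ThomQ n p m f x ≤ K * KuoQ n p m f x) := by
  obtain ⟨m, rfl⟩ := Nat.exists_eq_succ_of_ne_zero hm.ne'
  simp only [Nat.succ_eq_add_one, kuoQ_eq, thomQ_eq]
  constructor
  · obtain ⟨K, hK, hev⟩ := exists_norm_mul_absMinor_le (hf 0 (mem_of_mem_nhds hU))
    obtain ⟨K', hK', hpow⟩ := exists_sum_pow_le_of_le (α := Fin p → Fin n)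
      (β := Fin (p + 1) → Fin n) hK m
    obtain ⟨δ, hδ, hball⟩ := Metric.nhds_basis_closedBall.mem_iff.1 hev
    refine ⟨K', hK', δ, hδ, fun x hx => hpow _ _ _
      (fun ι => mul_nonneg (norm_nonneg x) (absMinor_nonneg _ ι)) (fun κ => absMinor_nonneg _ κ)
      (norm_nonneg _) (hball (mem_closedBall_zero_iff.2 hx))⟩
  · obtain ⟨K', hK', hpow⟩ := exists_sum_pow_le_of_le (α := Fin (p + 1) → Fin n)
      (β := Fin p → Fin n) (K := (p + 1) * 2) (by positivity) m
    refine ⟨K', hK', 1, one_pos, fun x _ => hpow _ _ _ (fun κ => absMinor_nonneg _ κ)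
      (fun ι => mul_nonneg (norm_nonneg x) (absMinor_nonneg _ ι)) (norm_nonneg _) fun κ => ?_⟩
    refine (absMinor_appendRow_le _ (abs_two_mul_apply_le x) κ).trans ?_
    rw [← Finset.mul_sum, mul_assoc, mul_assoc]
    gcongr
    exact le_add_of_nonneg_right (norm_nonneg _)
end

section
/- Let n ≥ p ≥ 1 be integers, let m be a positive integer, and let f : ℝⁿ → ℝᵖ be a C¹ map on a neighbourhood of 0 with f(0)=0. Then T_m(f,·) ≲ K_m(f,·): there exist constants K, δ > 0 such that T_m(f,x) ≤ K·K_m(f,x) for all ‖x‖ ≤ δ. -/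
/-- A power of a determinant is controlled by a bound on its last row and a common bound on the
powers of the minors obtained by deleting the last row. -/
theorem Matrix.abs_det_pow_le_of_last_row {p m : ℕ} (A : Matrix (Fin (p + 1)) (Fin (p + 1)) ℝ)
    {c S : ℝ} (hc : 0 ≤ c) (hrow : ∀ k, |A (Fin.last p) k| ≤ c)
    (hminor : ∀ k : Fin (p + 1), |(A.submatrix Fin.castSucc k.succAbove).det| ^ m ≤ S) :
    |A.det| ^ m ≤ (c * (p + 1)) ^ m * S := by
  obtain ⟨k₀, -, hmax⟩ := Finset.exists_max_image Finset.univ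
    (fun k : Fin (p + 1) => |(A.submatrix Fin.castSucc k.succAbove).det|) Finset.univ_nonempty
  have hdet : |A.det| ≤ c * (p + 1) * |(A.submatrix Fin.castSucc k₀.succAbove).det| := by
    rw [Matrix.det_succ_row A (Fin.last p), Fin.succAbove_last]
    calc _ ≤ _ := Finset.abs_sum_le_sum_abs _ _
      _ ≤ ∑ _k : Fin (p + 1), c * |(A.submatrix Fin.castSucc k₀.succAbove).det| := by
        refine Finset.sum_le_sum fun k hk => ?_
        rw [abs_mul, abs_mul, abs_pow, abs_neg, abs_one, one_pow, one_mul]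
        exact mul_le_mul (hrow k) (hmax k hk) (abs_nonneg _) hc
      _ = _ := by
        simp only [Finset.sum_const, Finset.card_univ, Fintype.card_fin, nsmul_eq_mul]
        push_cast
        ring
  calc |A.det| ^ m ≤ (c * (p + 1) * |(A.submatrix Fin.castSucc k₀.succAbove).det|) ^ m :=
        pow_le_pow_left₀ (abs_nonneg _) hdet m
    _ = (c * (p + 1)) ^ m * |(A.submatrix Fin.castSucc k₀.succAbove).det| ^ m := mul_pow _ _ _
    _ ≤ _ := mul_le_mul_of_nonneg_left (hminor k₀) (by positivity)

/-- The Thom quantity is bounded by a multiple of the Kuo quantity at every point. -/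
theorem ThomQ_le_mul_KuoQ (n p m : ℕ)
    (f : EuclideanSpace ℝ (Fin n) → EuclideanSpace ℝ (Fin p))
    (x : EuclideanSpace ℝ (Fin n)) :
    ThomQ n p m f x ≤
      (Fintype.card (Fin (p + 1) → Fin n) * (2 * (p + 1)) ^ m + 1) * KuoQ n p m f x := by
  classical
  unfold ThomQ KuoQ
  set S : ℝ := ∑ ι : Fin p → Fin n,
    (if StrictMono ι then
      |(Matrix.det fun j k : Fin p => fderiv ℝ f x (EuclideanSpace.single (ι k) 1) j)| ^ m
    else 0) with hS
  have hterm : ∀ ι : Fin p → Fin n, 0 ≤ (if StrictMono ι then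
      |(Matrix.det fun j k : Fin p => fderiv ℝ f x (EuclideanSpace.single (ι k) 1) j)| ^ m
      else 0) := by
    intro ι
    split_ifs <;> positivity
  have hS0 : 0 ≤ S := Finset.sum_nonneg fun ι _ => hterm ι
  have hle : ∀ ι : Fin p → Fin n, StrictMono ι →
      |(Matrix.det fun j k : Fin p => fderiv ℝ f x (EuclideanSpace.single (ι k) 1) j)| ^ m ≤ S := by
    intro ι hι
    have h := Finset.single_le_sum (fun κ _ => hterm κ) (Finset.mem_univ ι)
    rw [if_pos hι] at h
    exact h
  have hsum : (∑ ι : Fin (p + 1) → Fin n,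
      if StrictMono ι then
        |(Matrix.det fun j k : Fin (p + 1) =>
            if h : (j : ℕ) < p then fderiv ℝ f x (EuclideanSpace.single (ι k) 1) ⟨j, h⟩
            else 2 * x (ι k))| ^ m
      else 0) ≤ ∑ _ι : Fin (p + 1) → Fin n, (2 * ‖x‖ * (p + 1)) ^ m * S := by
    refine Finset.sum_le_sum fun ι _ => ?_
    split_ifs with hι
    · refine Matrix.abs_det_pow_le_of_last_row _ (by positivity) (fun k => ?_) fun k => ?_
      · have hx : |x (ι k)| ≤ ‖x‖ := PiLp.norm_apply_le x (ι k)
        simpa [abs_mul] using hx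
      · refine le_trans (le_of_eq ?_)
          (hle (ι ∘ k.succAbove) (hι.comp (Fin.strictMono_succAbove k)))
        congr 3
        ext i j
        simp [Matrix.submatrix]
    · positivity
  rw [Finset.sum_const, Finset.card_univ, nsmul_eq_mul] at hsum
  set N : ℝ := (Fintype.card (Fin (p + 1) → Fin n) : ℝ)
  have hN : 0 ≤ N := Nat.cast_nonneg _
  have hpow : (2 * ‖x‖ * ((p : ℝ) + 1)) ^ m = (2 * ((p : ℝ) + 1)) ^ m * ‖x‖ ^ m := by
    rw [← mul_pow]
    ring
  rw [hpow] at hsum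
  have h₁ : 0 ≤ N * (2 * ((p : ℝ) + 1)) ^ m * ‖f x‖ ^ m := by positivity
  have h₂ : 0 ≤ ‖x‖ ^ m * S := by positivity
  linarith

theorem thom_le_kuo_C1 (n p : ℕ) (hp : 1 ≤ p) (hpn : p ≤ n) (m : ℕ) (hm : 0 < m)
    (f : EuclideanSpace ℝ (Fin n) → EuclideanSpace ℝ (Fin p))
    (U : Set (EuclideanSpace ℝ (Fin n))) (hU : U ∈ nhds 0)
    (hf : ContDiffOn ℝ 1 f U) (hf0 : f 0 = 0) :
    ∃ K > (0 : ℝ), ∃ δ > (0 : ℝ), ∀ x : EuclideanSpace ℝ (Fin n),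
      ‖x‖ ≤ δ → ThomQ n p m f x ≤ K * KuoQ n p m f x :=
  ⟨_, by positivity, 1, one_pos, fun x _ => ThomQ_le_mul_KuoQ n p m f x⟩
end
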